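/- arXiv:2005.03136 — 12 statements merged into one kernel-verified Lean document; each statement's English description precedes it below -/
import Mathlib

section
/- Suppose there exists μ > 1 such that M_P(2μ) ≤ μ² and M_P(μ)·(M_P(μ) − 1) < μ (with both exponential moments finite). Then M_P(μ)·(M_P(μ) − 1)/μ − 1 < 0 and the solution u satisfies u(t)² ≤ exp( 2·(M_P(μ)·(M_P(μ) − 1)/μ − 1)·t ) for all t ≥ 0; in particular t ↦ u(t)² is nonincreasing on [0,∞) and u(t) converges exponentially to 0 as t → ∞. -/
open MeasureTheory Filter

/-- Exponential moments satisfy `M(μ) ≤ μ` as soon as `M(2μ) ≤ μ²`. -/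
theorem integral_exp_le_of_integral_exp_two_mul_le
    {P : Measure ℝ} [IsProbabilityMeasure P] {μ : ℝ} (hμ : 0 < μ)
    (hM2_int : Integrable (fun s => Real.exp (2 * μ * s)) P)
    (hM1_int : Integrable (fun s => Real.exp (μ * s)) P)
    (h1 : (∫ s, Real.exp (2 * μ * s) ∂P) ≤ μ ^ 2) :
    (∫ s, Real.exp (μ * s) ∂P) ≤ μ := by
  have h : (∫ s, 2 * μ * Real.exp (μ * s) ∂P) ≤ ∫ s, (Real.exp (2 * μ * s) + μ ^ 2) ∂P := by
    refine integral_mono (hM1_int.const_mul _) (hM2_int.add (integrable_const _)) fun s => ?_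
    have : Real.exp (2 * μ * s) = Real.exp (μ * s) ^ 2 := by
      rw [← Real.exp_nat_mul]; congr 1; push_cast; ring
    simp only [this]
    nlinarith [sq_nonneg (Real.exp (μ * s) - μ)]
  rw [integral_const_mul, integral_add hM2_int (integrable_const _)] at h
  simp only [integral_const, probReal_univ, smul_eq_mul, one_mul] at h
  nlinarith

/-- Convolution of a continuous function, constant on `(-∞, 0]`, with a probability measure
supported on `[0, ∞)` is continuous. -/
theorem continuous_integral_comp_sub
    {P : Measure ℝ} [IsProbabilityMeasure P] (hP : ∀ᵐ s ∂P, 0 ≤ s)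
    {u : ℝ → ℝ} (hu_cont : Continuous u) (hu_init : ∀ t ≤ (0 : ℝ), u t = 1) :
    Continuous fun t => ∫ s, u (t - s) ∂P := by
  rw [continuous_iff_continuousAt]
  intro t₀
  obtain ⟨C, hC⟩ := (isCompact_Icc (a := (0 : ℝ)) (b := t₀ + 1)).exists_bound_of_continuousOn
    hu_cont.continuousOn
  refine continuousAt_of_dominated (bound := fun _ => max C 1) ?_ ?_ (integrable_const _) ?_
  · exact Eventually.of_forall fun t => (by fun_prop : Continuous _).aestronglyMeasurable
  · filter_upwards [Iio_mem_nhds (lt_add_one t₀)] with t ht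
    filter_upwards [hP] with s hs
    rcases le_total (t - s) 0 with h | h
    · simp [hu_init _ h]
    · exact (hC _ ⟨h, by linarith [Set.mem_Iio.1 ht]⟩).trans (le_max_left _ _)
  · exact Eventually.of_forall fun s => (by fun_prop : Continuous _).continuousAt

/-- If `μ u + u' > 0` on `(0, T)`, where `u = 1` on `(-∞, 0]` and `μ > 0`, then `e^{μ t} u(t)` is
strictly increasing on `(-∞, T]`. -/
theorem strictMonoOn_exp_mul_Iic
    {u u' : ℝ → ℝ} {μ T : ℝ} (hμ : 0 < μ) (hT : 0 ≤ T) (hu_cont : Continuous u)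
    (hu_init : ∀ t ≤ (0 : ℝ), u t = 1) (hu : ∀ t > (0 : ℝ), HasDerivAt u (u' t) t)
    (hpos : ∀ t, 0 < t → t < T → 0 < μ * u t + u' t) :
    StrictMonoOn (fun t => Real.exp (μ * t) * u t) (Set.Iic T) := by
  have hleft : StrictMonoOn (fun t => Real.exp (μ * t) * u t) (Set.Iic 0) := by
    intro a ha b hb hab
    simp only [hu_init a ha, hu_init b hb, mul_one]
    exact Real.exp_lt_exp.2 (by nlinarith)
  have hright : StrictMonoOn (fun t => Real.exp (μ * t) * u t) (Set.Icc 0 T) := by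
    refine strictMonoOn_of_deriv_pos (convex_Icc 0 T) (by fun_prop) fun t ht => ?_
    rw [interior_Icc] at ht
    have hd : HasDerivAt (fun t => Real.exp (μ * t) * u t) _ t :=
      (((hasDerivAt_id t).const_mul μ).exp).mul (hu t ht.1)
    rw [hd.deriv]
    have := mul_pos (Real.exp_pos (μ * t)) (hpos t ht.1 ht.2)
    simp only [id]
    linarith
  have := hleft.union hright isGreatest_Iic (isLeast_Icc hT)
  rwa [Set.Iic_union_Icc_eq_Iic hT] at this

/-- Solutions of `u' = -∫ u(t - s) dP(s)` with `u = 1` on `(-∞, 0]` satisfy `u' > -μ u` if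
`μ > 1` and `M(μ) ≤ μ`. -/
theorem integral_comp_sub_lt_mul
    {P : Measure ℝ} [IsProbabilityMeasure P] (hP : ∀ᵐ s ∂P, 0 ≤ s)
    {u : ℝ → ℝ} (hu_cont : Continuous u)
    (hu_init : ∀ t ≤ (0 : ℝ), u t = 1)
    (hu_int : ∀ t > (0 : ℝ), Integrable (fun s => u (t - s)) P)
    (hu_ode : ∀ t > (0 : ℝ), HasDerivAt u (-∫ s, u (t - s) ∂P) t)
    {μ : ℝ} (hμ : 1 < μ)
    (hM_int : Integrable (fun s => Real.exp (μ * s)) P)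
    (hM : (∫ s, Real.exp (μ * s) ∂P) ≤ μ) {t : ℝ} (ht : 0 ≤ t) :
    (∫ s, u (t - s) ∂P) < μ * u t := by
  by_contra! hcon
  let S : Set ℝ := {t | 0 ≤ t ∧ μ * u t ≤ ∫ s, u (t - s) ∂P}
  have hS : IsClosed S := (isClosed_le continuous_const continuous_id).inter
    (isClosed_le (by fun_prop) (continuous_integral_comp_sub hP hu_cont hu_init))
  have hbdd : BddBelow S := ⟨0, fun _ hx => hx.1⟩
  obtain ⟨hT0, hT⟩ : sInf S ∈ S := hS.csInf_mem ⟨t, ht, hcon⟩ hbdd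
  set T := sInf S
  have hTpos : 0 < T := by
    refine hT0.lt_of_ne fun h => ?_
    rw [← h, hu_init 0 le_rfl, integral_congr_ae (g := fun _ => (1 : ℝ))
      (hP.mono fun s hs => hu_init _ (by simpa using hs))] at hT
    simp at hT
    linarith
  have hmono := strictMonoOn_exp_mul_Iic (by linarith : 0 < μ) hT0 hu_cont hu_init hu_ode
    fun r hr hrT => by
      by_contra! h
      exact absurd (csInf_le hbdd (show r ∈ S from ⟨hr.le, by linarith⟩)) (not_le.2 hrT)
  have huT : 0 < u T := by
    have := hmono hT0 (Set.mem_Iic.2 le_rfl) hTpos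
    simp only [mul_zero, Real.exp_zero, hu_init 0 le_rfl, mul_one] at this
    exact pos_of_mul_pos_right (one_pos.trans this) (Real.exp_pos _).le
  have hexp (s : ℝ) : Real.exp (μ * T) = Real.exp (μ * (T - s)) * Real.exp (μ * s) := by
    rw [← Real.exp_add]; ring_nf
  have hlt {s : ℝ} (hs : 0 < s) : u (T - s) < Real.exp (μ * s) * u T := by
    have := hmono (Set.mem_Iic.2 (by linarith : T - s ≤ T)) (Set.mem_Iic.2 le_rfl)
      (by linarith : T - s < T)
    simp only [hexp s, mul_assoc] at this
    exact lt_of_mul_lt_mul_left this (Real.exp_pos _).le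
  have hnn : 0 ≤ᵐ[P] fun s => Real.exp (μ * s) * u T - u (T - s) := by
    filter_upwards [hP] with s hs
    rcases hs.eq_or_lt with rfl | hs
    · simp
    · simpa using (hlt hs).le
  have hi : Integrable (fun s => Real.exp (μ * s) * u T - u (T - s)) P :=
    (hM_int.mul_const _).sub (hu_int T hTpos)
  have hle : (∫ s, (Real.exp (μ * s) * u T - u (T - s)) ∂P) ≤ 0 := by
    rw [integral_sub (hM_int.mul_const _) (hu_int T hTpos), integral_mul_const]
    linarith [mul_le_mul_of_nonneg_right hM huT.le]
  have hzero := (integral_eq_zero_iff_of_nonneg_ae hnn hi).1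
    (hle.antisymm (integral_nonneg_of_ae hnn))
  have hs0 : ∀ᵐ s ∂P, u (T - s) = u T := by
    filter_upwards [hP, hzero] with s hs hz
    rcases hs.eq_or_lt with rfl | hs
    · simp
    · exact absurd hz (sub_pos.2 (hlt hs)).ne'
  rw [integral_congr_ae hs0] at hT
  simp at hT
  nlinarith

/-- Main decay theorem: if there is `μ > 1` with `M_P(2μ) ≤ μ²` and
`M_P(μ)(M_P(μ)-1) < μ`, then the exponent coefficient is negative, `u(t)²`
decays at least exponentially, is nonincreasing on `[0,∞)`, and `u → 0`. -/
theorem stmt_0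
    (P : Measure ℝ) [IsProbabilityMeasure P] (hPsupp : P (Set.Iio 0) = 0)
    (u : ℝ → ℝ) (hu_cont : Continuous u)
    (hu_init : ∀ t ≤ (0 : ℝ), u t = 1)
    (hu_int : ∀ t > (0 : ℝ), Integrable (fun s => u (t - s)) P)
    (hu_ode : ∀ t > (0 : ℝ), HasDerivAt u (-∫ s, u (t - s) ∂P) t)
    (μ : ℝ) (hμ : 1 < μ)
    (hM2_int : Integrable (fun s => Real.exp (2 * μ * s)) P)
    (hM1_int : Integrable (fun s => Real.exp (μ * s)) P)
    (h1 : (∫ s, Real.exp (2 * μ * s) ∂P) ≤ μ ^ 2)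
    (h2 : (∫ s, Real.exp (μ * s) ∂P) * ((∫ s, Real.exp (μ * s) ∂P) - 1) < μ) :
    (∫ s, Real.exp (μ * s) ∂P) * ((∫ s, Real.exp (μ * s) ∂P) - 1) / μ - 1 < 0 ∧
    (∀ t ≥ (0 : ℝ), u t ^ 2 ≤
      Real.exp (2 * ((∫ s, Real.exp (μ * s) ∂P) *
        ((∫ s, Real.exp (μ * s) ∂P) - 1) / μ - 1) * t)) ∧
    AntitoneOn (fun t => u t ^ 2) (Set.Ici 0) ∧
    Tendsto u atTop (nhds 0) := by
  have hP : ∀ᵐ s ∂P, 0 ≤ s := by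
    rw [ae_iff]
    simp only [not_le]
    exact hPsupp
  have hμ0 : 0 < μ := by linarith
  have hM := integral_exp_le_of_integral_exp_two_mul_le hμ0 hM2_int hM1_int h1
  have hM1 : 1 ≤ ∫ s, Real.exp (μ * s) ∂P := by
    have := integral_mono_ae (integrable_const (1 : ℝ)) hM1_int
      (hP.mono fun s hs => Real.one_le_exp (mul_nonneg hμ0.le hs))
    simpa using this
  have hmono (T : ℝ) (hT : 0 ≤ T) := strictMonoOn_exp_mul_Iic hμ0 hT hu_cont hu_init hu_ode
    fun r hr _ => by
      linarith [integral_comp_sub_lt_mul hP hu_cont hu_init hu_int hu_ode hμ hM1_int hM hr.le]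
  have hpos (t : ℝ) : 0 < u t := by
    rcases le_or_gt t 0 with ht | ht
    · simp [hu_init t ht]
    · have := hmono t ht.le ht.le (Set.mem_Iic.2 le_rfl) ht
      simp only [mul_zero, Real.exp_zero, hu_init 0 le_rfl, mul_one] at this
      exact pos_of_mul_pos_right (one_pos.trans this) (Real.exp_pos _).le
  have hanti : AntitoneOn u (Set.Ici 0) := by
    refine antitoneOn_of_deriv_nonpos (convex_Ici 0) hu_cont.continuousOn ?_ ?_
    · intro t ht
      rw [interior_Ici] at ht
      exact (hu_ode t ht).differentiableAt.differentiableWithinAt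
    · intro t ht
      rw [interior_Ici] at ht
      rw [(hu_ode t ht).deriv]
      exact neg_nonpos.2 (integral_nonneg fun s => (hpos _).le)
  have hdelay {t : ℝ} (ht : 0 < t) : u t ≤ ∫ s, u (t - s) ∂P := by
    have := integral_mono_ae (integrable_const (u t)) (hu_int t ht) (hP.mono fun s hs => by
      rcases le_total 0 (t - s) with h | h
      · exact hanti h ht.le (by linarith)
      · simpa only [hu_init _ h, hu_init 0 le_rfl] using hanti Set.self_mem_Ici ht.le ht.le)
    simpa using this
  have hw : AntitoneOn (fun t => Real.exp t * u t) (Set.Ici 0) := by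
    have hd (t : ℝ) (ht : 0 < t) := (Real.hasDerivAt_exp t).mul (hu_ode t ht)
    refine antitoneOn_of_deriv_nonpos (convex_Ici 0) (by fun_prop) ?_ ?_
    · intro t ht
      rw [interior_Ici] at ht
      exact (hd t ht).differentiableAt.differentiableWithinAt
    · intro t ht
      rw [interior_Ici] at ht
      have hdt : HasDerivAt (fun t => Real.exp t * u t) _ t := hd t ht
      rw [hdt.deriv]
      linarith [mul_le_mul_of_nonneg_left (hdelay ht) (Real.exp_pos t).le]
  have hdecay {t : ℝ} (ht : 0 ≤ t) : u t ≤ Real.exp (-t) := by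
    have := hw (Set.mem_Ici.2 le_rfl) ht ht
    simp only [Real.exp_zero, hu_init 0 le_rfl, mul_one] at this
    rw [Real.exp_neg, ← one_div, le_div_iff₀ (Real.exp_pos t)]
    linarith
  refine ⟨?_, fun t ht => ?_, fun a ha b hb hab => ?_, ?_⟩
  · rw [sub_neg, div_lt_one hμ0]
    exact h2
  · have hc : 0 ≤ (∫ s, Real.exp (μ * s) ∂P) * ((∫ s, Real.exp (μ * s) ∂P) - 1) / μ :=
      div_nonneg (mul_nonneg (by linarith) (by linarith)) hμ0.le
    calc u t ^ 2 ≤ Real.exp (-t) ^ 2 := pow_le_pow_left₀ (hpos t).le (hdecay ht) 2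
      _ = Real.exp (2 * (-t)) := by rw [← Real.exp_nat_mul]; norm_num
      _ ≤ _ := Real.exp_le_exp.2 (by nlinarith)
  · exact pow_le_pow_left₀ (hpos b).le (hanti ha hb hab) 2
  · refine squeeze_zero' (Eventually.of_forall fun t => (hpos t).le) ?_
      Real.tendsto_exp_neg_atTop_nhds_zero
    filter_upwards [eventually_ge_atTop 0] with t ht using hdecay ht
end

section
/- Suppose there exists μ > 1 such that M_P(2μ) ≤ μ² (with M_P(2μ) finite). Then for all t > 0 and all s > 0 one has the two-sided bound e^{−2μ s}·y(t) < y(t−s) < e^{2μ s}·y(t), where y(t) := u(t)²/2 (and y(r) = 1/2 for r ≤ 0). -/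
open MeasureTheory Filter

/-- A continuous function that is strictly increasing on `(-∞, 0]` and has positive derivative
on `(0, T)` is strictly increasing on `(-∞, T]`. -/
theorem strictMonoOn_Iic_of_hasDerivAt_pos {v v' : ℝ → ℝ} {T : ℝ} (hT : 0 ≤ T)
    (hv : Continuous v) (hneg : StrictMonoOn v (Set.Iic 0))
    (hderiv : ∀ r ∈ Set.Ioo 0 T, HasDerivAt v (v' r) r) (hpos : ∀ r ∈ Set.Ioo 0 T, 0 < v' r) :
    StrictMonoOn v (Set.Iic T) := by
  have hmono : StrictMonoOn v (Set.Icc 0 T) := by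
    refine strictMonoOn_of_deriv_pos (convex_Icc 0 T) hv.continuousOn fun r hr => ?_
    rw [interior_Icc] at hr
    rw [(hderiv r hr).deriv]
    exact hpos r hr
  rw [← Set.Iic_union_Icc_eq_Iic hT]
  exact hneg.union hmono isGreatest_Iic (isLeast_Icc hT)

/-- The delay average `t ↦ ∫ u (t - s) dP(s)` of a continuous function that is constant
on `(-∞, 0]` is continuous, for a finite measure `P` on `[0, ∞)`. -/
theorem continuous_integral_delay {P : Measure ℝ} [IsFiniteMeasure P]
    (hP : ∀ᵐ s ∂P, 0 ≤ s) {u : ℝ → ℝ} (hu : Continuous u) (hu_init : ∀ t ≤ 0, u t = 1) :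
    Continuous fun t => ∫ s, u (t - s) ∂P := by
  refine continuous_iff_continuousAt.2 fun t₀ => ?_
  obtain ⟨C, hC⟩ := (isCompact_Icc (a := (0 : ℝ)) (b := |t₀| + 1)).exists_bound_of_continuousOn
    hu.continuousOn
  have hbound : ∀ r ≤ |t₀| + 1, ‖u r‖ ≤ C := by
    intro r hr
    rcases le_total r 0 with h | h
    · rw [hu_init r h, ← hu_init 0 le_rfl]
      exact hC 0 ⟨le_rfl, by positivity⟩
    · exact hC r ⟨h, hr⟩
  refine continuousAt_of_dominated (bound := fun _ => C) (Eventually.of_forall fun t => ?_) ?_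
    (integrable_const C) (Eventually.of_forall fun s => ?_)
  · exact (hu.comp (continuous_const.sub continuous_id)).aestronglyMeasurable
  · filter_upwards [Iio_mem_nhds (lt_add_one t₀)] with t ht
    filter_upwards [hP] with s hs
    exact hbound _ (by linarith [le_abs_self t₀, Set.mem_Iio.1 ht])
  · exact (hu.comp (continuous_id.sub continuous_const)).continuousAt

/-- If `f 0 ≤ c`, `f s < exp (μ s) * c` for all `s > 0`, and
`∫ exp (2 μ s) dP(s) ≤ μ²` with `μ > 1`, then `∫ f dP < μ * c`. -/
theorem integral_lt_mul_of_lt_exp_mul {P : Measure ℝ} [IsProbabilityMeasure P]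
    (hP : ∀ᵐ s ∂P, 0 ≤ s) {μ c : ℝ} (hμ : 1 < μ) (hc : 0 < c)
    (hM_int : Integrable (fun s => Real.exp (2 * μ * s)) P)
    (hM : (∫ s, Real.exp (2 * μ * s) ∂P) ≤ μ ^ 2) {f : ℝ → ℝ} (hf : Integrable f P)
    (hf_zero : f 0 ≤ c) (hf_pos : ∀ s > 0, f s < Real.exp (μ * s) * c) :
    ∫ s, f s ∂P < μ * c := by
  have hμ0 : 0 < μ := by linarith
  -- Bounding `exp (μ s)` by an arithmetic mean keeps the inequality strict at `s = 0`.
  set g : ℝ → ℝ := fun s => c / (2 * μ) * Real.exp (2 * μ * s) + μ * c / 2 with hg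
  have hg_int : Integrable g P := (hM_int.const_mul _).add (integrable_const _)
  have hfg : ∀ s, 0 ≤ s → f s < g s := by
    intro s hs
    have hgs : g s = Real.exp (μ * s) * c + c / (2 * μ) * (Real.exp (μ * s) - μ) ^ 2 := by
      have : Real.exp (2 * μ * s) = Real.exp (μ * s) ^ 2 := by
        rw [← Real.exp_nat_mul]; congr 1; push_cast; ring
      simp only [hg, this]
      field_simp
      ring
    rw [hgs]
    rcases hs.eq_or_lt with rfl | hs
    · have hne : 1 - μ ≠ 0 := by linarith
      have : 0 < c / (2 * μ) * (1 - μ) ^ 2 := by positivity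
      simp only [mul_zero, Real.exp_zero, one_mul]
      linarith
    · have : 0 ≤ c / (2 * μ) * (Real.exp (μ * s) - μ) ^ 2 := by positivity
      linarith [hf_pos s hs]
  have hlt : ∫ s, f s ∂P < ∫ s, g s ∂P := by
    rw [← sub_pos, ← integral_sub hg_int hf]
    have hpos : ∀ᵐ s ∂P, 0 < g s - f s := hP.mono fun s hs => sub_pos.2 (hfg s hs)
    rw [integral_pos_iff_support_of_nonneg_ae (hpos.mono fun _ h => h.le) (hg_int.sub hf)]
    have hsupp : P (Function.support fun s => g s - f s) = 1 :=
      (measure_congr (eventuallyEq_univ.2 (hpos.mono fun _ h => h.ne'))).trans measure_univ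
    rw [hsupp]
    exact one_pos
  refine hlt.trans_le ?_
  have hg_eq : ∫ s, g s ∂P = c / (2 * μ) * (∫ s, Real.exp (2 * μ * s) ∂P) + μ * c / 2 := by
    rw [hg, integral_add (hM_int.const_mul _) (integrable_const _), integral_const_mul]
    simp
  calc ∫ s, g s ∂P ≤ c / (2 * μ) * μ ^ 2 + μ * c / 2 := by rw [hg_eq]; gcongr
    _ = μ * c := by field_simp; ring

/-- Two-sided delay estimate for `y(t) = u(t)²/2` under `M_P(2μ) ≤ μ²`. -/
theorem stmt_1
    (P : Measure ℝ) [IsProbabilityMeasure P] (hPsupp : P (Set.Iio 0) = 0)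
    (u : ℝ → ℝ) (hu_cont : Continuous u)
    (hu_init : ∀ t ≤ (0 : ℝ), u t = 1)
    (hu_int : ∀ t > (0 : ℝ), Integrable (fun s => u (t - s)) P)
    (hu_ode : ∀ t > (0 : ℝ), HasDerivAt u (-∫ s, u (t - s) ∂P) t)
    (μ : ℝ) (hμ : 1 < μ)
    (hM2_int : Integrable (fun s => Real.exp (2 * μ * s)) P)
    (h1 : (∫ s, Real.exp (2 * μ * s) ∂P) ≤ μ ^ 2)
    (y : ℝ → ℝ) (hy : ∀ t, y t = u t ^ 2 / 2) :
    ∀ t > (0 : ℝ), ∀ s > (0 : ℝ),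
      Real.exp (-(2 * μ * s)) * y t < y (t - s) ∧
      y (t - s) < Real.exp (2 * μ * s) * y t := by
  have hP : ∀ᵐ s ∂P, 0 ≤ s := by
    simp only [ae_iff, not_le]
    exact hPsupp
  set I : ℝ → ℝ := fun t => ∫ s, u (t - s) ∂P with hI
  have hI_cont : Continuous I := continuous_integral_delay hP hu_cont hu_init
  have hμ0 : 0 < μ := by linarith
  have hgrow : ∀ T ≥ 0, (∀ r ∈ Set.Ioo 0 T, |I r| < μ * u r) →
      StrictMonoOn (fun t => Real.exp (μ * t) * u t) (Set.Iic T) := by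
    intro T hT hr
    refine strictMonoOn_Iic_of_hasDerivAt_pos hT (by fun_prop) ?_
      (v' := fun r => Real.exp (μ * r) * μ * u r + Real.exp (μ * r) * -I r) ?_ ?_
    · intro a ha b hb hab
      simp only [hu_init a ha, hu_init b hb, mul_one]
      gcongr
    · intro r hr
      exact ((hasDerivAt_const_mul μ).exp).mul (hu_ode r hr.1)
    · intro r hr'
      have := (abs_lt.1 (hr r hr')).2
      have := mul_pos (Real.exp_pos (μ * r)) (sub_pos.2 this)
      linarith
  have hdecay : ∀ T ≥ 0, (∀ r ∈ Set.Ioo 0 T, |I r| < μ * u r) →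
      StrictMonoOn (fun t => -(Real.exp (-μ * t) * u t)) (Set.Iic T) := by
    intro T hT hr
    refine strictMonoOn_Iic_of_hasDerivAt_pos hT (by fun_prop) ?_
      (v' := fun r => -(Real.exp (-μ * r) * -μ * u r + Real.exp (-μ * r) * -I r)) ?_ ?_
    · intro a ha b hb hab
      simp only [hu_init a ha, hu_init b hb, mul_one, neg_mul]
      gcongr
    · intro r hr
      exact (((hasDerivAt_const_mul (-μ)).exp).mul (hu_ode r hr.1)).neg
    · intro r hr'
      have := (abs_lt.1 (hr r hr')).1
      have := mul_pos (Real.exp_pos (-μ * r)) (sub_pos.2 this)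
      linarith
  have hexp : ∀ c t s : ℝ, Real.exp (c * t) = Real.exp (c * (t - s)) * Real.exp (c * s) := by
    intro c t s
    rw [← Real.exp_add]
    congr 1
    ring
  have hupper : ∀ T ≥ 0, (∀ r ∈ Set.Ioo 0 T, |I r| < μ * u r) → ∀ s > 0,
      u (T - s) < Real.exp (μ * s) * u T := by
    intro T hT hr s hs
    have h := hgrow T hT hr (by simp [hs.le] : T - s ∈ Set.Iic T) Set.self_mem_Iic (by linarith)
    simp only [hexp μ T s, mul_assoc] at h
    exact lt_of_mul_lt_mul_left h (Real.exp_pos _).le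
  have hlower : ∀ T ≥ 0, (∀ r ∈ Set.Ioo 0 T, |I r| < μ * u r) → ∀ s > 0,
      Real.exp (-μ * s) * u T < u (T - s) := by
    intro T hT hr s hs
    have h := hdecay T hT hr (by simp [hs.le] : T - s ∈ Set.Iic T) Set.self_mem_Iic (by linarith)
    simp only [hexp (-μ) T s, mul_assoc, neg_lt_neg_iff] at h
    exact lt_of_mul_lt_mul_left h (Real.exp_pos _).le
  have hu_pos : ∀ T ≥ 0, (∀ r ∈ Set.Ioo 0 T, |I r| < μ * u r) → 0 < u T := by
    intro T hT hr
    have h := hupper T hT hr (T + 1) (by linarith)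
    rw [hu_init _ (by linarith)] at h
    exact pos_of_mul_pos_right (one_pos.trans h) (Real.exp_pos _).le
  have hderiv_bound : ∀ t ≥ 0, |I t| < μ * u t := by
    by_contra! hbad
    set B : Set ℝ := {t | 0 ≤ t ∧ μ * u t ≤ |I t|} with hB
    have hB_closed : IsClosed B :=
      (isClosed_le continuous_const continuous_id).inter
        (isClosed_le (hu_cont.const_mul μ) hI_cont.abs)
    have hB_bdd : BddBelow B := ⟨0, fun _ h => h.1⟩
    obtain ⟨hT, hTbad⟩ : sInf B ∈ B := hB_closed.csInf_mem hbad hB_bdd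
    set T := sInf B
    have hr : ∀ r ∈ Set.Ioo 0 T, |I r| < μ * u r := by
      intro r hr
      by_contra! h
      exact hr.2.not_ge (csInf_le hB_bdd ⟨hr.1.le, h⟩)
    have hI_nonneg : 0 ≤ I T := by
      refine integral_nonneg_of_ae ?_
      filter_upwards [hP] with s hs
      have hexp_pos := mul_pos (Real.exp_pos (-μ * s)) (hu_pos T hT hr)
      rcases hs.eq_or_lt with rfl | hs
      · simpa using (hu_pos T hT hr).le
      · exact (hexp_pos.trans (hlower T hT hr s hs)).le
    have hint : Integrable (fun s => u (T - s)) P := by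
      rcases hT.eq_or_lt with h | h
      · rw [← h]
        refine (integrable_const (1 : ℝ)).congr ?_
        filter_upwards [hP] with s hs
        rw [hu_init _ (by linarith)]
      · exact hu_int T h
    have hlt : I T < μ * u T :=
      integral_lt_mul_of_lt_exp_mul hP hμ (hu_pos T hT hr) hM2_int h1 hint (by simp)
        (hupper T hT hr)
    rw [abs_of_nonneg hI_nonneg] at hTbad
    exact hTbad.not_gt hlt
  intro t ht s hs
  have hr : ∀ T, ∀ r ∈ Set.Ioo 0 T, |I r| < μ * u r := fun T r hr => hderiv_bound r hr.1.le
  have hut := hu_pos t ht.le (hr t)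
  have hlow := hlower t ht.le (hr t) s hs
  have hup := hupper t ht.le (hr t) s hs
  have hlow_pos : 0 < Real.exp (-μ * s) * u t := by positivity
  have hsq : ∀ c : ℝ, Real.exp (2 * (c * s)) = Real.exp (c * s) ^ 2 := by
    intro c
    rw [← Real.exp_nat_mul]
    norm_num
  rw [hy, hy, show -(2 * μ * s) = 2 * (-μ * s) by ring, mul_assoc 2 μ s, hsq, hsq]
  have hlow_sq := pow_lt_pow_left₀ hlow hlow_pos.le two_ne_zero
  have hup_sq := pow_lt_pow_left₀ hup (hlow_pos.trans hlow).le two_ne_zero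
  rw [mul_pow] at hlow_sq hup_sq
  constructor <;> linarith
end

section
/- Suppose there exists μ > 1 such that M_P(2μ) ≤ μ² (with M_P(2μ) finite). Then for every t > 0, with y(t) := u(t)²/2, one has the strict logarithmic derivative bound |y'(t)| < 2μ·y(t); in particular y(t) > 0 for all t > 0. -/
open MeasureTheory Filter

/-- If a probability measure `P` on `[0,∞)` satisfies `M_P(2μ) ≤ μ²` with `μ > 1`, then a function
dominated by `c e^{μ s}`, strictly so for `s > 0`, has `P`-mean less than `μ c`. -/
theorem integral_lt_mul_of_lt_mul_exp
    (P : Measure ℝ) [IsProbabilityMeasure P] (hPsupp : P (Set.Iio 0) = 0)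
    {μ c : ℝ} (hμ : 1 < μ) (hc : 0 < c)
    (hM2_int : Integrable (fun s => Real.exp (2 * μ * s)) P)
    (h1 : (∫ s, Real.exp (2 * μ * s) ∂P) ≤ μ ^ 2)
    {f : ℝ → ℝ} (hf : Integrable f P) (hf0 : f 0 ≤ c)
    (hlt : ∀ s > 0, f s < c * Real.exp (μ * s)) :
    ∫ s, f s ∂P < μ * c := by
  have hμ0 : 0 < μ := by linarith
  set g : ℝ → ℝ := fun s => c / (2 * μ) * Real.exp (2 * μ * s) + c * μ / 2 with hg
  have hg_int : Integrable g P := (hM2_int.const_mul _).add (integrable_const _)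
  have hg_eq : ∀ s, g s = c * Real.exp (μ * s) + c / (2 * μ) * (Real.exp (μ * s) - μ) ^ 2 := by
    intro s
    have h2 : Real.exp (2 * μ * s) = Real.exp (μ * s) ^ 2 := by
      rw [← Real.exp_nat_mul]; congr 1; push_cast; ring
    simp only [hg, h2]
    field_simp
    ring
  have hpos : ∀ s, 0 ≤ s → f s < g s := by
    intro s hs
    rw [hg_eq]
    have hk : 0 < c / (2 * μ) := by positivity
    rcases hs.eq_or_lt with rfl | hs
    · have : 0 < (Real.exp (μ * 0) - μ) ^ 2 := by
        rw [mul_zero, Real.exp_zero]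
        exact sq_pos_of_neg (by linarith)
      have := mul_pos hk this
      simp only [mul_zero, Real.exp_zero, mul_one] at this ⊢
      linarith
    · have := mul_nonneg hk.le (sq_nonneg (Real.exp (μ * s) - μ))
      linarith [hlt s hs]
  have hae : ∀ᵐ s ∂P, f s < g s := by
    have : ∀ᵐ s ∂P, s ∉ Set.Iio (0 : ℝ) := measure_eq_zero_iff_ae_notMem.1 hPsupp
    filter_upwards [this] with s hs
    exact hpos s (not_lt.1 hs)
  have hfg : ∫ s, f s ∂P < ∫ s, g s ∂P := by
    rw [← sub_pos, ← integral_sub hg_int hf]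
    refine (integral_nonneg_of_ae (hae.mono fun s hs => (sub_pos.2 hs).le)).lt_of_ne' fun h0 => ?_
    rw [integral_eq_zero_iff_of_nonneg_ae (hae.mono fun s hs => (sub_pos.2 hs).le)
      (hg_int.sub hf)] at h0
    obtain ⟨s, hs, hs'⟩ := (h0.and hae).exists
    exact (sub_pos.2 hs').ne' hs
  refine hfg.trans_le ?_
  rw [hg, integral_add (hM2_int.const_mul _) (integrable_const _), integral_const_mul]
  simp only [integral_const, probReal_univ, smul_eq_mul, one_mul]
  calc c / (2 * μ) * (∫ s, Real.exp (2 * μ * s) ∂P) + c * μ / 2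
      ≤ c / (2 * μ) * μ ^ 2 + c * μ / 2 := by gcongr
    _ = μ * c := by field_simp; ring

/-- A function continuous on `ℝ` which is strictly increasing on `(-∞,0]` is strictly increasing
provided it exceeds its value at `0` at points arbitrarily close to the right of `0`, and no
`t > 0` at which it is larger than at all earlier points is a local maximum. -/
theorem strictMono_of_not_isLocalMax {h : ℝ → ℝ} (hcont : Continuous h)
    (hinit : StrictMonoOn h (Set.Iic 0))
    (hstart : ∀ t > 0, ∃ r ∈ Set.Icc 0 t, h 0 < h r)
    (hrec : ∀ t > 0, (∀ r < t, h r < h t) → ¬ IsLocalMax h t) : StrictMono h := by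
  have hrecord : ∀ t > 0, ∀ r ∈ Set.Ico 0 t, h r < h t := by
    intro t ht r₀ hr₀
    by_contra! hle
    obtain ⟨m, hm, hmax⟩ := (isCompact_Icc (a := (0 : ℝ)) (b := t)).exists_isMaxOn
      ⟨0, by simp [ht.le]⟩ hcont.continuousOn
    have hK : IsCompact (Set.Icc 0 t ∩ h ⁻¹' {h m}) :=
      isCompact_Icc.inter_right (isClosed_singleton.preimage hcont)
    obtain ⟨a, ⟨ha, hha⟩, hleast⟩ := hK.exists_isLeast ⟨m, hm, rfl⟩
    replace hha : h a = h m := hha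
    have hmaxa : ∀ x ∈ Set.Icc 0 t, h x ≤ h a := fun x hx => hha ▸ hmax hx
    have hbefore : ∀ x ∈ Set.Ico 0 a, h x < h a := fun x hx =>
      (hmaxa x ⟨hx.1, hx.2.le.trans ha.2⟩).lt_of_ne fun he =>
        hx.2.not_ge (hleast ⟨⟨hx.1, hx.2.le.trans ha.2⟩, he.trans hha⟩)
    have hat : a < t := ha.2.lt_of_ne fun he => by
      subst he
      exact hle.not_gt (hbefore r₀ hr₀)
    rcases ha.1.eq_or_lt with rfl | ha0
    · obtain ⟨r, hr, hr'⟩ := hstart t ht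
      exact hr'.not_ge (hmaxa r hr)
    · refine hrec a ha0 (fun r hr => ?_) ?_
      · rcases lt_or_ge r 0 with hr0 | hr0
        · exact (hinit hr0.le Set.self_mem_Iic hr0).trans (hbefore 0 ⟨le_rfl, ha0⟩)
        · exact hbefore r ⟨hr0, hr⟩
      · filter_upwards [Icc_mem_nhds ha0 hat] with x hx using hmaxa x hx
  intro r t hrt
  rcases le_or_gt t 0 with ht | ht
  · exact hinit (hrt.le.trans ht) ht hrt
  · rcases lt_or_ge r 0 with hr0 | hr0
    · exact (hinit hr0.le Set.self_mem_Iic hr0).trans (hrecord t ht 0 ⟨le_rfl, ht⟩)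
    · exact hrecord t ht r ⟨hr0, hrt⟩

/-- Logarithmic derivative bound `|y'(t)| < 2μ y(t)` for `y = u²/2`,
together with positivity of `y` on `(0,∞)`. -/
theorem stmt_3
    (P : Measure ℝ) [IsProbabilityMeasure P] (hPsupp : P (Set.Iio 0) = 0)
    (u : ℝ → ℝ) (hu_cont : Continuous u)
    (hu_init : ∀ t ≤ (0 : ℝ), u t = 1)
    (hu_int : ∀ t > (0 : ℝ), Integrable (fun s => u (t - s)) P)
    (hu_ode : ∀ t > (0 : ℝ), HasDerivAt u (-∫ s, u (t - s) ∂P) t)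
    (μ : ℝ) (hμ : 1 < μ)
    (hM2_int : Integrable (fun s => Real.exp (2 * μ * s)) P)
    (h1 : (∫ s, Real.exp (2 * μ * s) ∂P) ≤ μ ^ 2)
    (y : ℝ → ℝ) (hy : ∀ t, y t = u t ^ 2 / 2) :
    ∀ t > (0 : ℝ), |deriv y t| < 2 * μ * y t ∧ 0 < y t := by
  have hμ0 : 0 < μ := by linarith
  have hrel : ∀ t s, Real.exp (μ * (t - s)) * u (t - s) < Real.exp (μ * t) * u t ↔
      u (t - s) < u t * Real.exp (μ * s) := by
    intro t s
    have : Real.exp (μ * t) = Real.exp (μ * (t - s)) * Real.exp (μ * s) := by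
      rw [← Real.exp_add]; ring_nf
    rw [this, mul_assoc, mul_lt_mul_iff_right₀ (Real.exp_pos _), mul_comm (u t)]
  have hbound : ∀ t > 0,
      (∀ r < t, Real.exp (μ * r) * u r < Real.exp (μ * t) * u t) →
        ∫ s, u (t - s) ∂P < μ * u t := by
    intro t ht hr
    have hut : 0 < u t := by
      have := hr 0 ht
      rw [hu_init 0 le_rfl, mul_zero, Real.exp_zero, mul_one] at this
      exact pos_of_mul_pos_right (one_pos.trans this) (Real.exp_pos _).le
    exact integral_lt_mul_of_lt_mul_exp P hPsupp hμ hut hM2_int h1 (hu_int t ht)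
      (by simp) fun s hs => (hrel t s).1 (hr _ (by linarith))
  have hmono : StrictMono fun t => Real.exp (μ * t) * u t := by
    apply strictMono_of_not_isLocalMax
    · fun_prop
    · intro a ha b hb hab
      simpa [hu_init a ha, hu_init b hb, hμ0] using hab
    · intro t ht
      by_contra! hle
      simp only [mul_zero, Real.exp_zero, hu_init 0 le_rfl, mul_one] at hle
      have hu_le : ∀ r ≤ t, u r ≤ 1 := by
        intro r hr
        rcases le_or_gt r 0 with hr0 | hr0
        · exact (hu_init r hr0).le
        · by_contra! hlt
          have h3 : 1 < Real.exp (μ * r) := Real.one_lt_exp_iff.2 (mul_pos hμ0 hr0)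
          nlinarith [hle r ⟨hr0.le, hr⟩]
      have hu_ge : ∀ r ∈ Set.Icc 0 t, 1 - r ≤ u r := by
        intro r hr
        have := (convex_Icc 0 t).mul_sub_le_image_sub_of_le_deriv (C := -1)
          hu_cont.continuousOn
          (fun x hx => by
            rw [interior_Icc] at hx
            exact (hu_ode x hx.1).differentiableAt.differentiableWithinAt)
          (fun x hx => by
            rw [interior_Icc] at hx
            rw [(hu_ode x hx.1).deriv, neg_le_neg_iff]
            have hae : ∀ᵐ s ∂P, s ∉ Set.Iio (0 : ℝ) := measure_eq_zero_iff_ae_notMem.1 hPsupp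
            calc ∫ s, u (x - s) ∂P ≤ ∫ _, (1 : ℝ) ∂P :=
                  integral_mono_ae (hu_int x hx.1) (integrable_const _) (hae.mono fun s hs =>
                    hu_le _ (by linarith [Set.notMem_Iio.1 hs, hx.2]))
              _ = 1 := by simp)
          0 ⟨le_rfl, ht.le⟩ r hr hr.1
        rw [hu_init 0 le_rfl] at this
        linarith
      set r := min t ((μ - 1) / (2 * μ)) with hr_def
      have hr0 : 0 < r := lt_min ht (div_pos (by linarith) (by linarith))
      have hrμ : r * (2 * μ) ≤ μ - 1 := (le_div_iff₀ (by linarith)).1 (min_le_right _ _)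
      have hr : r ∈ Set.Icc 0 t := ⟨hr0.le, min_le_left _ _⟩
      have h1r : 0 < 1 - r := by nlinarith
      have h4 : (μ * r + 1) * (1 - r) ≤ 1 :=
        (mul_le_mul (Real.add_one_le_exp _) (hu_ge r hr) h1r.le (Real.exp_pos _).le).trans
          (hle r hr)
      have h5 : 0 < r * (μ - 1 - μ * r) := mul_pos hr0 (by linarith)
      linarith [show (μ * r + 1) * (1 - r) = 1 + r * (μ - 1 - μ * r) by ring]
    · intro t ht hr hmax
      have hexp : HasDerivAt (fun t => Real.exp (μ * t)) (Real.exp (μ * t) * μ) t := by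
        simpa using ((hasDerivAt_id t).const_mul μ).exp
      have h0 := hmax.hasDerivAt_eq_zero (hexp.mul (hu_ode t ht))
      have h6 := mul_pos (Real.exp_pos (μ * t)) (sub_pos.2 (hbound t ht hr))
      linarith
  have hu_pos : ∀ t, 0 < u t := by
    intro t
    rcases le_or_gt t 0 with ht | ht
    · simp [hu_init t ht]
    · have := hmono ht
      simp only [hu_init 0 le_rfl, mul_zero, Real.exp_zero, mul_one] at this
      exact pos_of_mul_pos_right (one_pos.trans this) (Real.exp_pos _).le
  intro t ht
  have hut := hu_pos t
  have hI := hbound t ht fun r hr => hmono hr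
  have hI0 : 0 ≤ ∫ s, u (t - s) ∂P := integral_nonneg fun s => (hu_pos _).le
  have hderiv : HasDerivAt y (-(u t * ∫ s, u (t - s) ∂P)) t := by
    rw [funext hy]
    refine (((hu_ode t ht).pow 2).div_const 2).congr_deriv ?_
    push_cast
    ring
  rw [hderiv.deriv, hy, abs_neg, abs_of_nonneg (mul_nonneg hut.le hI0)]
  exact ⟨by linarith [mul_lt_mul_of_pos_left hI hut,
      show u t * (μ * u t) = 2 * μ * (u t ^ 2 / 2) by ring],
    by positivity⟩
end

section
/- If 0 < τ < (ln 2)/2, then μ = 2 satisfies both e^{2μτ} ≤ μ² and e^{μτ}·(e^{μτ} − 1) < μ. Consequently (by the main decay theorem applied to P = δ_τ), the solution u of the constant-delay negative feedback equation u'(t) = −u(t−τ) for t > 0 with u ≡ 1 on (−∞,0] satisfies u(t)² ≤ exp( 2·( e^{2τ}(e^{2τ} − 1)/2 − 1 )·t ) for all t ≥ 0, with a strictly negative exponent coefficient. -/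
open Filter

section DelayEquation

variable {τ T : ℝ} {u : ℝ → ℝ}

/-- As long as `u (s - τ) ≤ 2 * u s`, the function `t ↦ exp (2 * t) * u t` is nondecreasing. -/
lemma monotoneOn_exp_two_mul_of_delay_le (hT : 0 ≤ T) (hu_cont : Continuous u)
    (hu_init : ∀ t ≤ (0 : ℝ), u t = 1)
    (hu_ode : ∀ t > (0 : ℝ), HasDerivAt u (-u (t - τ)) t)
    (hle : ∀ s, 0 < s → s < T → u (s - τ) ≤ 2 * u s) :
    MonotoneOn (fun t => Real.exp (2 * t) * u t) (Set.Iic T) := by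
  have hneg : MonotoneOn (fun t => Real.exp (2 * t) * u t) (Set.Iic 0) := by
    intro a ha b hb hab
    simp only [hu_init a ha, hu_init b hb, mul_one]
    gcongr
  have hpos : MonotoneOn (fun t => Real.exp (2 * t) * u t) (Set.Icc 0 T) := by
    refine monotoneOn_of_hasDerivWithinAt_nonneg (convex_Icc 0 T) (by fun_prop)
      (f' := fun s => Real.exp (2 * s) * (2 * 1) * u s + Real.exp (2 * s) * -u (s - τ)) ?_ ?_
    · intro s hs
      rw [interior_Icc] at hs
      exact ((((hasDerivAt_id s).const_mul 2).exp).mul (hu_ode s hs.1)).hasDerivWithinAt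
    · intro s hs
      rw [interior_Icc] at hs
      have := mul_nonneg (Real.exp_pos (2 * s)).le (sub_nonneg.2 (hle s hs.1 hs.2))
      linarith
  rw [← Set.Iic_union_Icc_eq_Iic hT]
  exact hneg.union_right hpos isGreatest_Iic (isLeast_Icc hT)

/-- If `t ↦ exp (2 * t) * u t` is nondecreasing up to time `T`, then `u` is positive up to time `T`. -/
lemma pos_of_monotoneOn_exp_two_mul (hu_init : ∀ t ≤ (0 : ℝ), u t = 1)
    (hmono : MonotoneOn (fun t => Real.exp (2 * t) * u t) (Set.Iic T)) {t : ℝ} (ht : t ≤ T) :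
    0 < u t := by
  rcases le_total t 0 with h | h
  · simp [hu_init t h]
  · have h1 := hmono (h.trans ht : (0 : ℝ) ≤ T) ht h
    simp only [hu_init 0 le_rfl, mul_zero, Real.exp_zero, mul_one] at h1
    exact pos_of_mul_pos_right (one_pos.trans_le h1) (Real.exp_pos _).le

/-- For `exp (2 * τ) < 2` the solution of `u' (t) = -u (t - τ)` with constant history `1` loses
less than half of its value over one delay. -/
lemma delay_lt_two_mul (hτ0 : 0 < τ) (hτ : Real.exp (2 * τ) < 2) (hu_cont : Continuous u)
    (hu_init : ∀ t ≤ (0 : ℝ), u t = 1)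
    (hu_ode : ∀ t > (0 : ℝ), HasDerivAt u (-u (t - τ)) t) {t : ℝ} (ht : 0 ≤ t) :
    u (t - τ) < 2 * u t := by
  by_contra! hcon
  let S : Set ℝ := {s | 0 ≤ s ∧ 2 * u s ≤ u (s - τ)}
  have hS : IsClosed S :=
    isClosed_Ici.inter (isClosed_le (continuous_const.mul hu_cont)
      (hu_cont.comp (continuous_sub_right τ)))
  have hbdd : BddBelow S := ⟨0, fun s hs => hs.1⟩
  obtain ⟨hT, hTle⟩ : sInf S ∈ S := hS.csInf_mem ⟨t, ht, hcon⟩ hbdd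
  have hmono := monotoneOn_exp_two_mul_of_delay_le (τ := τ) hT hu_cont hu_init hu_ode
    fun s hs0 hs => by
      by_contra! h
      exact notMem_of_lt_csInf hs hbdd ⟨hs0.le, h.le⟩
  generalize sInf S = T at *
  have hu := pos_of_monotoneOn_exp_two_mul hu_init hmono le_rfl
  have h := hmono (show T - τ ≤ T by linarith) (le_refl T) (by linarith)
  have hexp : Real.exp (2 * T) = Real.exp (2 * (T - τ)) * Real.exp (2 * τ) := by
    rw [← Real.exp_add]
    ring_nf
  simp only [hexp, mul_assoc] at h
  have h' := le_of_mul_le_mul_left h (Real.exp_pos _)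
  nlinarith

/-- For `exp (2 * τ) < 2` the solution of `u' (t) = -u (t - τ)` with constant history `1` is
positive. -/
lemma delay_solution_pos (hτ0 : 0 < τ) (hτ : Real.exp (2 * τ) < 2) (hu_cont : Continuous u)
    (hu_init : ∀ t ≤ (0 : ℝ), u t = 1)
    (hu_ode : ∀ t > (0 : ℝ), HasDerivAt u (-u (t - τ)) t) (t : ℝ) : 0 < u t := by
  refine pos_of_monotoneOn_exp_two_mul (T := max t 0) hu_init ?_ (le_max_left t 0)
  exact monotoneOn_exp_two_mul_of_delay_le (le_max_right t 0) hu_cont hu_init hu_ode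
    fun s hs _ => (delay_lt_two_mul hτ0 hτ hu_cont hu_init hu_ode hs.le).le

/-- A positive solution of `u' (t) = -u (t - τ)` with constant history `1` is nonincreasing. -/
lemma antitone_of_delay_solution_pos (hu_cont : Continuous u)
    (hu_init : ∀ t ≤ (0 : ℝ), u t = 1)
    (hu_ode : ∀ t > (0 : ℝ), HasDerivAt u (-u (t - τ)) t) (hpos : ∀ t, 0 < u t) :
    Antitone u := by
  have hneg : AntitoneOn u (Set.Iic 0) := fun a ha b hb _ => by
    rw [hu_init a ha, hu_init b hb]
  refine hneg.Iic_union_Ici (antitoneOn_of_hasDerivWithinAt_nonpos (convex_Ici 0)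
    hu_cont.continuousOn (f' := fun s => -u (s - τ)) ?_ fun s _ => (neg_neg_of_pos (hpos _)).le)
  intro s hs
  rw [interior_Ici] at hs
  exact (hu_ode s hs).hasDerivWithinAt

/-- A positive solution of `u' (t) = -u (t - τ)` with constant history `1` is bounded by
`exp (-t)`. -/
lemma le_exp_neg_of_delay_solution_pos (hτ0 : 0 ≤ τ) (hu_cont : Continuous u)
    (hu_init : ∀ t ≤ (0 : ℝ), u t = 1)
    (hu_ode : ∀ t > (0 : ℝ), HasDerivAt u (-u (t - τ)) t) (hpos : ∀ t, 0 < u t)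
    {t : ℝ} (ht : 0 ≤ t) : u t ≤ Real.exp (-t) := by
  have hu := antitone_of_delay_solution_pos hu_cont hu_init hu_ode hpos
  have hanti : AntitoneOn (fun t => Real.exp t * u t) (Set.Ici 0) := by
    refine antitoneOn_of_hasDerivWithinAt_nonpos (convex_Ici 0) (by fun_prop)
      (f' := fun s => Real.exp s * u s + Real.exp s * -u (s - τ)) ?_ ?_
    · intro s hs
      rw [interior_Ici] at hs
      exact ((Real.hasDerivAt_exp s).mul (hu_ode s hs)).hasDerivWithinAt
    · intro s _
      have := mul_le_mul_of_nonneg_left (hu (sub_le_self s hτ0)) (Real.exp_pos s).le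
      linarith
  have h := hanti (Set.self_mem_Ici) ht ht
  simp only [hu_init 0 le_rfl, Real.exp_zero, mul_one] at h
  rw [Real.exp_neg, ← one_div, le_div_iff₀' (Real.exp_pos t)]
  exact h

end DelayEquation

/-- For `0 < τ < (ln 2)/2`, `μ = 2` verifies both moment conditions for the Dirac
measure `δ_τ`, and the solution of `u' (t) = -u(t-τ)` decays exponentially. -/
theorem stmt_7 (τ : ℝ) (hτ0 : 0 < τ) (hτ : τ < Real.log 2 / 2)
    (u : ℝ → ℝ) (hu_cont : Continuous u)
    (hu_init : ∀ t ≤ (0 : ℝ), u t = 1)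
    (hu_ode : ∀ t > (0 : ℝ), HasDerivAt u (-u (t - τ)) t) :
    Real.exp (2 * 2 * τ) ≤ (2 : ℝ) ^ 2 ∧
    Real.exp (2 * τ) * (Real.exp (2 * τ) - 1) < 2 ∧
    Real.exp (2 * τ) * (Real.exp (2 * τ) - 1) / 2 - 1 < 0 ∧
    ∀ t ≥ (0 : ℝ), u t ^ 2 ≤
      Real.exp (2 * (Real.exp (2 * τ) * (Real.exp (2 * τ) - 1) / 2 - 1) * t) := by
  have h2 : Real.exp (2 * τ) < 2 := by
    rw [← Real.lt_log_iff_exp_lt two_pos]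
    linarith
  have h1 : 1 < Real.exp (2 * τ) := Real.one_lt_exp_iff.2 (by linarith)
  have hsq : Real.exp (2 * 2 * τ) = Real.exp (2 * τ) ^ 2 := by
    rw [← Real.exp_nat_mul]
    ring_nf
  have hprod : Real.exp (2 * τ) * (Real.exp (2 * τ) - 1) < 2 := by nlinarith
  refine ⟨?_, hprod, by linarith, fun t ht => ?_⟩
  · rw [hsq]
    gcongr
  · have hpos := delay_solution_pos hτ0 h2 hu_cont hu_init hu_ode
    have hk : 0 ≤ Real.exp (2 * τ) * (Real.exp (2 * τ) - 1) :=
      mul_nonneg (Real.exp_pos _).le (by linarith)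
    calc u t ^ 2 ≤ Real.exp (-t) ^ 2 := pow_le_pow_left₀ (hpos t).le
          (le_exp_neg_of_delay_solution_pos hτ0.le hu_cont hu_init hu_ode hpos ht) 2
      _ = Real.exp (2 * -t) := by
          rw [← Real.exp_nat_mul]
          norm_num
      _ ≤ _ := Real.exp_le_exp.2 (by nlinarith [mul_nonneg hk ht])
end

section
/- If 0 < τ ≤ 1/e, then for every t > τ the function y(t) := u(t)²/2 satisfies y'(t) < ( (e^{eτ} − 1)/e − 1 )·u(t−τ)² ≤ −e^{−1}·u(t−τ)² ≤ 0; consequently y is nonincreasing on (τ,∞) and u(t) → 0 monotonically as t → ∞. -/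
open Filter

lemma hasDerivAt_mul_exp {u : ℝ → ℝ} {k v t : ℝ} (hu : HasDerivAt u v t) :
    HasDerivAt (fun s => u s * Real.exp (k * s)) ((k * u t + v) * Real.exp (k * t)) t := by
  have h := hu.mul ((hasDerivAt_id t).const_mul k).exp
  refine h.congr_deriv ?_
  simp only [id_eq]
  ring

/-- If the logarithmic decay rate of a solution of the delay equation stays below `k` up to
time `T`, then `u s * exp (k * s)` is strictly increasing up to time `T`. -/
lemma strictMonoOn_mul_exp_of_delay {τ k T : ℝ} (hk : 0 < k) {u : ℝ → ℝ}
    (hu_cont : Continuous u) (hu_init : ∀ t ≤ (0 : ℝ), u t = 1)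
    (hu_ode : ∀ t > (0 : ℝ), HasDerivAt u (-u (t - τ)) t) (hT : 0 ≤ T)
    (hrate : ∀ s, 0 < s → s < T → u (s - τ) < k * u s) :
    StrictMonoOn (fun s => u s * Real.exp (k * s)) (Set.Iic T) := by
  have h₁ : StrictMonoOn (fun s => u s * Real.exp (k * s)) (Set.Iic 0) := by
    intro a ha b hb hab
    simp only [hu_init a ha, hu_init b hb, one_mul]
    gcongr
  have h₂ : StrictMonoOn (fun s => u s * Real.exp (k * s)) (Set.Icc 0 T) := by
    apply strictMonoOn_of_deriv_pos (convex_Icc 0 T) (by fun_prop)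
    intro s hs
    rw [interior_Icc] at hs
    rw [(hasDerivAt_mul_exp (hu_ode s hs.1)).deriv]
    exact mul_pos (by linarith [hrate s hs.1 hs.2]) (Real.exp_pos _)
  rw [← Set.Iic_union_Icc_eq_Iic hT]
  exact h₁.union h₂ isGreatest_Iic (isLeast_Icc hT)

/-- For delay `τ ≤ 1/e`, the solution satisfies `u (t - τ) < e * u t` for all `t`. -/
lemma delay_lt_exp_one_mul {τ : ℝ} (hτ0 : 0 < τ) (hτ : τ ≤ (Real.exp 1)⁻¹) {u : ℝ → ℝ}
    (hu_cont : Continuous u) (hu_init : ∀ t ≤ (0 : ℝ), u t = 1)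
    (hu_ode : ∀ t > (0 : ℝ), HasDerivAt u (-u (t - τ)) t) (t : ℝ) :
    u (t - τ) < Real.exp 1 * u t := by
  have he : 1 < Real.exp 1 := Real.one_lt_exp_iff.2 one_pos
  by_contra! ht
  set S : Set ℝ := {s | Real.exp 1 * u s ≤ u (s - τ)} with hS
  have hSpos : ∀ s ∈ S, 0 < s := by
    intro s hs
    by_contra! h
    simp only [hS, Set.mem_ofPred_eq, hu_init s h, hu_init (s - τ) (by linarith)] at hs
    linarith
  have hbdd : BddBelow S := ⟨0, fun s hs => (hSpos s hs).le⟩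
  have hclosed : IsClosed S := isClosed_le (by fun_prop) (by fun_prop)
  have hTS : sInf S ∈ S := hclosed.csInf_mem ⟨t, ht⟩ hbdd
  set T := sInf S
  have hT : 0 < T := hSpos T hTS
  have hmono := strictMonoOn_mul_exp_of_delay (by linarith) hu_cont hu_init hu_ode hT.le
    (fun s _ hsT => not_le.1 fun h => hsT.not_ge (csInf_le hbdd h))
  have hpos : 0 < u T := by
    have h := hmono (Set.mem_Iic.2 hT.le) Set.self_mem_Iic hT
    simp only [hu_init 0 le_rfl, mul_zero, Real.exp_zero, mul_one] at h
    exact pos_of_mul_pos_left (one_pos.trans h) (Real.exp_pos _).le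
  have h := hmono (Set.mem_Iic.2 (sub_lt_self T hτ0).le) Set.self_mem_Iic (sub_lt_self T hτ0)
  have hexp : Real.exp (Real.exp 1 * T) =
      Real.exp (Real.exp 1 * τ) * Real.exp (Real.exp 1 * (T - τ)) := by
    rw [← Real.exp_add]; ring_nf
  simp only [hexp, ← mul_assoc] at h
  have h' : u (T - τ) < u T * Real.exp (Real.exp 1 * τ) :=
    lt_of_mul_lt_mul_right h (Real.exp_pos _).le
  have hle : Real.exp (Real.exp 1 * τ) ≤ Real.exp 1 := by
    rw [Real.exp_le_exp]
    calc Real.exp 1 * τ ≤ Real.exp 1 * (Real.exp 1)⁻¹ := by gcongr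
      _ = 1 := mul_inv_cancel₀ (by positivity)
  have hTS' : Real.exp 1 * u T ≤ u (T - τ) := hTS
  nlinarith [mul_le_mul_of_nonneg_left hle hpos.le]

/-- Over one delay interval the solution retains more than the fraction
`1 - (exp (k * τ) - 1) / k` of its value. -/
lemma lt_of_strictMono_mul_exp {τ k t : ℝ} (hk : 0 < k) (hτ0 : 0 < τ) {u : ℝ → ℝ}
    (hu_cont : Continuous u) (hu_ode : ∀ t > (0 : ℝ), HasDerivAt u (-u (t - τ)) t)
    (hmono : StrictMono fun s => u s * Real.exp (k * s)) (ht : τ < t) :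
    (1 - (Real.exp (k * τ) - 1) / k) * u (t - τ) < u t := by
  have hF : StrictMonoOn (fun s => u s - u (t - τ) * (Real.exp (k * (t - s)) / k))
      (Set.Icc (t - τ) t) := by
    apply strictMonoOn_of_deriv_pos (convex_Icc _ _) (by fun_prop)
    intro s hs
    rw [interior_Icc] at hs
    have hd : HasDerivAt (fun s => u s - u (t - τ) * (Real.exp (k * (t - s)) / k))
        (-u (s - τ) + u (t - τ) * Real.exp (k * (t - s))) s := by
      have h := (hu_ode s (by linarith [hs.1])).sub
        (((((hasDerivAt_id s).const_sub t).const_mul k).exp.div_const k).const_mul (u (t - τ)))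
      refine h.congr_deriv ?_
      simp only [id_eq]
      field_simp
      ring
    rw [hd.deriv]
    have h : u (s - τ) * Real.exp (k * (s - τ)) < u (t - τ) * Real.exp (k * (t - τ)) :=
      hmono (by linarith [hs.2])
    have hexp : Real.exp (k * (t - τ)) =
        Real.exp (k * (t - s)) * Real.exp (k * (s - τ)) := by
      rw [← Real.exp_add]; ring_nf
    rw [hexp, ← mul_assoc] at h
    linarith [lt_of_mul_lt_mul_right h (Real.exp_pos _).le]
  have h := hF (Set.left_mem_Icc.2 (by linarith)) (Set.right_mem_Icc.2 (by linarith))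
    (sub_lt_self t hτ0)
  simp only [sub_self, mul_zero, Real.exp_zero, sub_sub_cancel] at h
  have : (1 - (Real.exp (k * τ) - 1) / k) * u (t - τ) =
      u (t - τ) - u (t - τ) * (Real.exp (k * τ) / k) + u (t - τ) * (1 / k) := by ring
  linarith

/-- A positive solution of the delay equation tends to `0`. -/
lemma tendsto_zero_of_delay_of_pos {τ : ℝ} (hτ0 : 0 < τ) {u : ℝ → ℝ}
    (hu_cont : Continuous u) (hu_init : ∀ t ≤ (0 : ℝ), u t = 1)
    (hu_ode : ∀ t > (0 : ℝ), HasDerivAt u (-u (t - τ)) t) (hpos : ∀ t, 0 < u t) :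
    Tendsto u atTop (nhds 0) := by
  have hanti : Antitone u := by
    have h₁ : AntitoneOn u (Set.Iic 0) := fun a ha b hb _ => by
      rw [hu_init a ha, hu_init b hb]
    have h₂ : AntitoneOn u (Set.Ici 0) := by
      apply antitoneOn_of_deriv_nonpos (convex_Ici 0) hu_cont.continuousOn
      · intro s hs
        rw [interior_Ici] at hs
        exact (hu_ode s hs).differentiableAt.differentiableWithinAt
      · intro s hs
        rw [interior_Ici] at hs
        rw [(hu_ode s hs).deriv]
        exact neg_nonpos.2 (hpos _).le
    exact h₁.Iic_union_Ici h₂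
  have hbound : ∀ t > (0 : ℝ), u t ≤ t⁻¹ := by
    intro t ht
    obtain ⟨c, hc, hc'⟩ := exists_hasDerivAt_eq_slope u (fun s => -u (s - τ)) ht
      hu_cont.continuousOn (fun s hs => hu_ode s hs.1)
    rw [hu_init 0 le_rfl, sub_zero, eq_div_iff ht.ne'] at hc'
    have hle : u t ≤ u (c - τ) := hanti (by linarith [hc.2])
    rw [le_inv_comm₀ (hpos t) ht, ← one_div, le_div_iff₀ (hpos t)]
    nlinarith [mul_le_mul_of_nonneg_right hle ht.le, hpos t]
  exact tendsto_of_tendsto_of_tendsto_of_le_of_le' tendsto_const_nhds tendsto_inv_atTop_zero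
    (Eventually.of_forall fun t => (hpos t).le)
    ((eventually_gt_atTop 0).mono hbound)

open Filter

/-- Sharp monotone-decay result for constant delay `τ ≤ 1/e`: for `t > τ`,
`y'(t) < ((e^{eτ}-1)/e - 1) u(t-τ)² ≤ -e⁻¹ u(t-τ)² ≤ 0`; consequently `y` is
nonincreasing on `(τ,∞)` and `u(t) → 0` as `t → ∞`. -/
theorem stmt_8 (τ : ℝ) (hτ0 : 0 < τ) (hτ : τ ≤ (Real.exp 1)⁻¹)
    (u : ℝ → ℝ) (hu_cont : Continuous u)
    (hu_init : ∀ t ≤ (0 : ℝ), u t = 1)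
    (hu_ode : ∀ t > (0 : ℝ), HasDerivAt u (-u (t - τ)) t)
    (y : ℝ → ℝ) (hy : ∀ t, y t = u t ^ 2 / 2) :
    (∀ t > τ,
      deriv y t < ((Real.exp (Real.exp 1 * τ) - 1) / Real.exp 1 - 1) * u (t - τ) ^ 2 ∧
      ((Real.exp (Real.exp 1 * τ) - 1) / Real.exp 1 - 1) * u (t - τ) ^ 2 ≤
        -(Real.exp 1)⁻¹ * u (t - τ) ^ 2 ∧
      -(Real.exp 1)⁻¹ * u (t - τ) ^ 2 ≤ 0) ∧
    AntitoneOn y (Set.Ioi τ) ∧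
    Tendsto u atTop (nhds 0) := by
  have he : 0 < Real.exp 1 := Real.exp_pos 1
  have hrate := delay_lt_exp_one_mul hτ0 hτ hu_cont hu_init hu_ode
  have hmono : StrictMono fun s => u s * Real.exp (Real.exp 1 * s) := by
    intro a b hab
    exact strictMonoOn_mul_exp_of_delay he hu_cont hu_init hu_ode (le_max_right b 0)
      (fun s _ _ => hrate s) (Set.mem_Iic.2 (hab.le.trans (le_max_left b 0)))
      (Set.mem_Iic.2 (le_max_left b 0)) hab
  have hpos : ∀ t, 0 < u t := by
    intro t
    rcases le_or_gt t 0 with ht | ht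
    · rw [hu_init t ht]
      exact one_pos
    · have h := hmono ht
      simp only [hu_init 0 le_rfl, mul_zero, Real.exp_zero, mul_one] at h
      exact pos_of_mul_pos_left (one_pos.trans h) (Real.exp_pos _).le
  have hy_deriv : ∀ t > (0 : ℝ), HasDerivAt y (-(u t * u (t - τ))) t := by
    intro t ht
    rw [funext hy]
    refine (((hu_ode t ht).pow 2).div_const 2).congr_deriv ?_
    push_cast
    ring
  refine ⟨fun t ht => ⟨?_, ?_, ?_⟩, ?_,
    tendsto_zero_of_delay_of_pos hτ0 hu_cont hu_init hu_ode hpos⟩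
  · rw [(hy_deriv t (hτ0.trans ht)).deriv]
    have h := mul_lt_mul_of_pos_right
      (lt_of_strictMono_mul_exp he hτ0 hu_cont hu_ode hmono ht) (hpos (t - τ))
    linarith
  · gcongr
    have hle : Real.exp (Real.exp 1 * τ) ≤ Real.exp 1 := by
      rw [Real.exp_le_exp]
      calc Real.exp 1 * τ ≤ Real.exp 1 * (Real.exp 1)⁻¹ := by gcongr
        _ = 1 := mul_inv_cancel₀ he.ne'
    calc (Real.exp (Real.exp 1 * τ) - 1) / Real.exp 1 - 1
        ≤ (Real.exp 1 - 1) / Real.exp 1 - 1 := by gcongr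
      _ = -(Real.exp 1)⁻¹ := by field_simp; ring
  · have : 0 ≤ (Real.exp 1)⁻¹ * u (t - τ) ^ 2 := by positivity
    linarith
  · apply antitoneOn_of_deriv_nonpos (convex_Ioi τ)
    · exact fun t ht => (hy_deriv t (hτ0.trans ht)).continuousAt.continuousWithinAt
    · rw [interior_Ioi]
      exact fun t ht => (hy_deriv t (hτ0.trans ht)).differentiableAt.differentiableWithinAt
    · rw [interior_Ioi]
      intro t ht
      rw [(hy_deriv t (hτ0.trans ht)).deriv]
      exact neg_nonpos.2 (mul_pos (hpos _) (hpos _)).le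
end

section
/- For every real a > (ln 2)/2 there is no μ > 1 such that both e^{2μa} ≤ μ² and e^{μa}·(e^{μa} − 1) < μ hold. Consequently, for any probability measure P on ℝ with P([a,∞)) = 1 (so that M_P(ν) ≥ e^{νa} for ν > 0), no μ > 1 satisfies both M_P(2μ) ≤ μ² and M_P(μ)·(M_P(μ) − 1) < μ. -/
open MeasureTheory

lemma two_mul_le_two_rpow_of_le_one {x : ℝ} (h0 : 0 ≤ x) (h1 : x ≤ 1) : 2 * x ≤ (2 : ℝ) ^ x := by
  have h : ((1 : ℝ) + 1) ^ (1 - x) ≤ 1 + (1 - x) * 1 :=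
    rpow_one_add_le_one_add_mul_self (by norm_num) (by linarith) (by linarith)
  have h2 : (2 : ℝ) ^ x * 2 ^ (1 - x) = 2 := by
    rw [← Real.rpow_add two_pos]
    norm_num
  have hpos : (0 : ℝ) < 2 ^ x := Real.rpow_pos_of_pos two_pos x
  norm_num at h
  nlinarith [mul_le_mul_of_nonneg_left h hpos.le, sq_nonneg (1 - x)]

lemma two_mul_le_two_rpow_mul_sub_one {x : ℝ} (h1 : 1 ≤ x) :
    2 * x ≤ (2 : ℝ) ^ x * (2 ^ x - 1) := by
  have h : 1 + x * 1 ≤ ((1 : ℝ) + 1) ^ x := one_add_mul_self_le_rpow_one_add (by norm_num) h1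
  norm_num at h
  nlinarith

lemma two_rpow_half_lt_exp_mul {a μ : ℝ} (ha : Real.log 2 / 2 < a) (hμ : 0 < μ) :
    (2 : ℝ) ^ (μ / 2) < Real.exp (μ * a) := by
  rw [Real.rpow_def_of_pos two_pos, Real.exp_lt_exp]
  nlinarith

lemma le_exp_mul_exp_sub_one_of_exp_le_sq {a μ : ℝ} (ha : Real.log 2 / 2 < a) (hμ : 1 < μ)
    (h₁ : Real.exp (2 * μ * a) ≤ μ ^ 2) :
    μ ≤ Real.exp (μ * a) * (Real.exp (μ * a) - 1) := by
  have hlt := two_rpow_half_lt_exp_mul ha (one_pos.trans hμ)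
  have hle : Real.exp (μ * a) ≤ μ := by
    refine le_of_sq_le_sq ?_ (by linarith)
    rwa [← Real.exp_nat_mul, Nat.cast_ofNat, ← mul_assoc]
  rcases le_total (μ / 2) 1 with h | h
  · linarith [two_mul_le_two_rpow_of_le_one (by linarith) h]
  · have h2 := two_mul_le_two_rpow_mul_sub_one h
    have h3 : (1 : ℝ) ≤ 2 ^ (μ / 2) := Real.one_le_rpow one_le_two (by linarith)
    nlinarith

lemma ofReal_exp_le_lintegral {a ν : ℝ} (hν : 0 ≤ ν) (P : Measure ℝ) [IsProbabilityMeasure P]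
    (hP : P (Set.Ici a) = 1) :
    ENNReal.ofReal (Real.exp (ν * a)) ≤ ∫⁻ s, ENNReal.ofReal (Real.exp (ν * s)) ∂P := by
  calc ENNReal.ofReal (Real.exp (ν * a))
      = ∫⁻ _ in Set.Ici a, ENNReal.ofReal (Real.exp (ν * a)) ∂P := by
        rw [setLIntegral_const, hP, mul_one]
    _ ≤ ∫⁻ s in Set.Ici a, ENNReal.ofReal (Real.exp (ν * s)) ∂P :=
        setLIntegral_mono (by fun_prop) fun s hs => ENNReal.ofReal_le_ofReal
          (Real.exp_le_exp.2 (mul_le_mul_of_nonneg_left hs hν))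
    _ ≤ _ := setLIntegral_le_lintegral _ _

/-- For `a > (ln 2)/2` no `μ > 1` satisfies both `e^{2μa} ≤ μ²` and
`e^{μa}(e^{μa}-1) < μ`; consequently, for any probability measure `P` supported
in `[a,∞)` (whose exponential moments, taken as lower integrals, may be
infinite), no `μ > 1` satisfies both `M_P(2μ) ≤ μ²` and `M_P(μ)(M_P(μ)-1) < μ`. -/
theorem stmt_9 (a : ℝ) (ha : Real.log 2 / 2 < a) :
    (¬ ∃ μ : ℝ, 1 < μ ∧ Real.exp (2 * μ * a) ≤ μ ^ 2 ∧
        Real.exp (μ * a) * (Real.exp (μ * a) - 1) < μ) ∧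
    (∀ (P : Measure ℝ) [IsProbabilityMeasure P], P (Set.Ici a) = 1 →
      ¬ ∃ μ : ℝ, 1 < μ ∧
        (∫⁻ s, ENNReal.ofReal (Real.exp (2 * μ * s)) ∂P) ≤ ENNReal.ofReal (μ ^ 2) ∧
        (∫⁻ s, ENNReal.ofReal (Real.exp (μ * s)) ∂P) *
          ((∫⁻ s, ENNReal.ofReal (Real.exp (μ * s)) ∂P) - 1) < ENNReal.ofReal μ) := by
  refine ⟨?_, ?_⟩
  · rintro ⟨μ, hμ, h₁, h₂⟩
    exact h₂.not_ge (le_exp_mul_exp_sub_one_of_exp_le_sq ha hμ h₁)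
  · rintro P _ hP ⟨μ, hμ, h₁, h₂⟩
    have h₁' : Real.exp (2 * μ * a) ≤ μ ^ 2 :=
      (ENNReal.ofReal_le_ofReal_iff (sq_nonneg μ)).1
        ((ofReal_exp_le_lintegral (by linarith) P hP).trans h₁)
    have hM := ofReal_exp_le_lintegral (ν := μ) (by linarith) P hP
    refine h₂.not_ge ?_
    calc ENNReal.ofReal μ
        ≤ ENNReal.ofReal (Real.exp (μ * a) * (Real.exp (μ * a) - 1)) :=
          ENNReal.ofReal_le_ofReal (le_exp_mul_exp_sub_one_of_exp_le_sq ha hμ h₁')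
      _ = ENNReal.ofReal (Real.exp (μ * a)) * (ENNReal.ofReal (Real.exp (μ * a)) - 1) := by
          rw [ENNReal.ofReal_mul (Real.exp_pos _).le, ENNReal.ofReal_sub _ zero_le_one,
            ENNReal.ofReal_one]
      _ ≤ _ := mul_le_mul' hM (tsub_le_tsub_right hM 1)
end

section
/- Let k > 0 and λ > 0. There exists μ with 0 < 2μ < λ and ( λ/(λ − 2μ) )^k ≤ μ² if and only if λ ≥ (k+2)^{(k+2)/2} / k^{k/2}. Moreover, when λ ≥ (k+2)^{(k+2)/2} / k^{k/2}, the choice μ = λ/(k+2) satisfies ( λ/(λ − 2μ) )^k ≤ μ². -/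
open Real in
lemma log_le_log_add_div_sub_one {a b : ℝ} (ha : 0 < a) (hb : 0 < b) :
    log a ≤ log b + (a / b - 1) := by
  have h := log_le_sub_one_of_pos (div_pos ha hb)
  rw [log_div ha.ne' hb.ne'] at h
  linarith

open Real in
lemma div_rpow_le_sq_iff_log {k l m μ : ℝ} (hl : 0 < l) (hm : 0 < m) (hμ : 0 < μ) :
    (l / m) ^ k ≤ μ ^ 2 ↔ k * (log l - log m) ≤ 2 * log μ := by
  rw [← log_le_log_iff (by positivity) (by positivity), log_rpow (by positivity),
    log_div hl.ne' hm.ne', log_pow]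
  norm_num

open Real in
lemma rpow_div_rpow_le_iff_log {k l : ℝ} (hk : 0 < k) (hl : 0 < l) :
    (k + 2) ^ ((k + 2) / 2) / k ^ (k / 2) ≤ l ↔
      (k + 2) / 2 * log (k + 2) - k / 2 * log k ≤ log l := by
  rw [← log_le_log_iff (by positivity) hl, log_div (by positivity) (by positivity),
    log_rpow (by positivity), log_rpow hk]

/-- Satisfiability of the first moment condition for the Gamma distribution:
`∃ μ, 0 < 2μ < λ ∧ (λ/(λ-2μ))^k ≤ μ²` iff `λ ≥ (k+2)^{(k+2)/2}/k^{k/2}`,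
and in that case `μ = λ/(k+2)` works. -/
theorem stmt_11 (k l : ℝ) (hk : 0 < k) (hl : 0 < l) :
    ((∃ μ : ℝ, 0 < 2 * μ ∧ 2 * μ < l ∧ (l / (l - 2 * μ)) ^ k ≤ μ ^ 2) ↔
      (k + 2) ^ ((k + 2) / 2) / k ^ (k / 2) ≤ l) ∧
    ((k + 2) ^ ((k + 2) / 2) / k ^ (k / 2) ≤ l →
      (l / (l - 2 * (l / (k + 2)))) ^ k ≤ (l / (k + 2)) ^ 2) := by
  have hk2 : 0 < k + 2 := by linarith
  have hsub : l - 2 * (l / (k + 2)) = l * k / (k + 2) := by field_simp; ring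
  have hlog : Real.log (l * k / (k + 2)) = Real.log l + Real.log k - Real.log (k + 2) := by
    rw [Real.log_div (by positivity) hk2.ne', Real.log_mul hl.ne' hk.ne']
  have hlog' : Real.log (l / (k + 2)) = Real.log l - Real.log (k + 2) :=
    Real.log_div hl.ne' hk2.ne'
  have choice : (k + 2) ^ ((k + 2) / 2) / k ^ (k / 2) ≤ l →
      (l / (l - 2 * (l / (k + 2)))) ^ k ≤ (l / (k + 2)) ^ 2 := by
    rw [rpow_div_rpow_le_iff_log hk hl, hsub,
      div_rpow_le_sq_iff_log hl (by positivity) (by positivity), hlog, hlog']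
    intro h
    linarith
  refine ⟨⟨?_, fun h => ⟨l / (k + 2), by positivity, ?_, choice h⟩⟩, choice⟩
  · rintro ⟨μ, hμ, hμl, h⟩
    have hμ0 : 0 < μ := by linarith
    have hm : 0 < l - 2 * μ := by linarith
    rw [div_rpow_le_sq_iff_log hl hm hμ0] at h
    rw [rpow_div_rpow_le_iff_log hk hl]
    have h1 := log_le_log_add_div_sub_one hm (show 0 < l * k / (k + 2) by positivity)
    have h2 := log_le_log_add_div_sub_one hμ0 (show 0 < l / (k + 2) by positivity)
    rw [hlog] at h1
    rw [hlog'] at h2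
    have h3 : k * ((l - 2 * μ) / (l * k / (k + 2)) - 1) + 2 * (μ / (l / (k + 2)) - 1) = 0 := by
      field_simp
      ring
    have h4 := mul_le_mul_of_nonneg_left h1 hk.le
    linarith
  · have : 0 < l * k / (k + 2) := by positivity
    linarith
end

section
/- For every real k with 0 < k ≤ 4, one has ( (k(k+2))^{k/2} / (k+1)^k ) · ( ((k+2)/(k+1))^k − 1 ) < 1. -/
lemma rpow_div_rpow_mul_one_add_le_one {k : ℝ} (hk0 : 0 < k) :
    (k * (k + 2)) ^ (k / 2) / (k + 1) ^ k * (1 + k / (2 * (k + 1) ^ 2)) ≤ 1 := by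
  have hden : (k + 1) ^ k = ((k + 1) ^ 2) ^ (k / 2) := by
    rw [← Real.rpow_natCast, ← Real.rpow_mul (by positivity)]
    congr 1
    push_cast
    ring
  have hbase : k * (k + 2) / (k + 1) ^ 2 ≤ Real.exp (-(1 / (k + 1) ^ 2)) := by
    have h := Real.add_one_le_exp (-(1 / (k + 1) ^ 2))
    have heq : k * (k + 2) / (k + 1) ^ 2 = -(1 / (k + 1) ^ 2) + 1 := by
      field_simp
      ring
    rwa [heq]
  rw [hden, ← Real.div_rpow (by positivity) (by positivity)]
  calc (k * (k + 2) / (k + 1) ^ 2) ^ (k / 2) * (1 + k / (2 * (k + 1) ^ 2))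
      ≤ Real.exp (-(1 / (k + 1) ^ 2)) ^ (k / 2) * Real.exp (k / (2 * (k + 1) ^ 2)) := by
        have h := Real.add_one_le_exp (k / (2 * (k + 1) ^ 2))
        rw [add_comm] at h
        gcongr
    _ = 1 := by
        rw [← Real.exp_mul, ← Real.exp_add, Real.exp_eq_one_iff]
        field_simp
        ring

lemma rpow_add_two_div_add_one_lt {k : ℝ} (hk0 : 0 < k) (hk4 : k ≤ 4) :
    ((k + 2) / (k + 1)) ^ k < 2 + k / (2 * (k + 1) ^ 2) := by
  have hsplit : (k + 2) / (k + 1) = 1 + 1 / (k + 1) := by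
    field_simp
    ring
  rcases le_total k 1 with hk1 | hk1
  · have hinv : (0 : ℝ) ≤ 1 / (k + 1) := by positivity
    have h := rpow_one_add_le_one_add_mul_self (s := 1 / (k + 1)) (by linarith) hk0.le hk1
    have hlt : k * (1 / (k + 1)) < 1 := by
      rw [mul_one_div, div_lt_one (by positivity)]
      linarith
    have hpos : 0 < k / (2 * (k + 1) ^ 2) := by positivity
    rw [hsplit]
    linarith
  · have hbase : (k + 2) / (k + 1) ≤ (1 + 1 / 5 : ℝ) ^ (4 / k) := by
      have h := one_add_mul_self_le_rpow_one_add (s := (1 / 5 : ℝ)) (by norm_num)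
        (p := 4 / k) (by rwa [le_div_iff₀ hk0, one_mul])
      refine le_trans ?_ h
      rw [hsplit, add_le_add_iff_left, div_mul_div_comm, div_le_div_iff₀ (by positivity)
        (by positivity)]
      linarith
    have hle : ((k + 2) / (k + 1)) ^ k ≤ (1 + 1 / 5 : ℝ) ^ (4 : ℕ) := by
      calc ((k + 2) / (k + 1)) ^ k ≤ ((1 + 1 / 5 : ℝ) ^ (4 / k)) ^ k := by gcongr
        _ = (1 + 1 / 5 : ℝ) ^ (4 : ℕ) := by
          rw [← Real.rpow_mul (by norm_num), div_mul_cancel₀ _ hk0.ne', ← Real.rpow_natCast]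
          norm_num
    have hfrac : 2 / 25 ≤ k / (2 * (k + 1) ^ 2) := by
      rw [div_le_div_iff₀ (by norm_num) (by positivity)]
      nlinarith
    norm_num at hle
    linarith

/-- For `0 < k ≤ 4`: `((k(k+2))^{k/2}/(k+1)^k) (((k+2)/(k+1))^k - 1) < 1`. -/
theorem stmt_12 (k : ℝ) (hk0 : 0 < k) (hk4 : k ≤ 4) :
    (k * (k + 2)) ^ (k / 2) / (k + 1) ^ k * (((k + 2) / (k + 1)) ^ k - 1) < 1 := by
  refine lt_of_lt_of_le ?_ (rpow_div_rpow_mul_one_add_le_one hk0)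
  have h := rpow_add_two_div_add_one_lt hk0 hk4
  exact mul_lt_mul_of_pos_left (by linarith) (by positivity)
end

section
/- Let 0 < k ≤ 4 and λ ≥ (k+2)^{(k+2)/2} / k^{k/2}, and set μ := λ/(k+2) and M(ν) := ( λ/(λ − ν) )^k for 0 ≤ ν < λ. Then μ > 1, M(2μ) ≤ μ², and M(μ)·(M(μ) − 1) < μ; i.e., the hypotheses of the main decay theorem are satisfied by the Gamma distribution with shape k and rate λ. -/
/-- A consequence of Bernoulli's inequality: `(1 + s) ^ x ≤ (1 + t) ^ y` when `x ≤ y` and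
`x * s ≤ y * t`. -/
lemma one_add_rpow_le_one_add_rpow {x y s t : ℝ} (hx : 0 < x) (hxy : x ≤ y) (hs : 0 ≤ s)
    (ht : 0 ≤ t) (h : x * s ≤ y * t) : (1 + s) ^ x ≤ (1 + t) ^ y := by
  have hB : 1 + y / x * t ≤ (1 + t) ^ (y / x) :=
    one_add_mul_self_le_rpow_one_add (by linarith) ((one_le_div hx).2 hxy)
  have hst : s ≤ y / x * t := by
    rw [div_mul_eq_mul_div, le_div_iff₀ hx]
    linarith
  calc (1 + s) ^ x ≤ ((1 + t) ^ (y / x)) ^ x :=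
        Real.rpow_le_rpow (by linarith) (by linarith) hx.le
    _ = (1 + t) ^ y := by
        rw [← Real.rpow_mul (by linarith), div_mul_cancel₀ _ hx.ne']

lemma add_two_div_add_one_rpow_mono {x y : ℝ} (hx : 0 < x) (hxy : x ≤ y) :
    ((x + 2) / (x + 1)) ^ x ≤ ((y + 2) / (y + 1)) ^ y := by
  have hy : 0 < y := hx.trans_le hxy
  have e (z : ℝ) (hz : 0 < z) : (z + 2) / (z + 1) = 1 + 1 / (z + 1) := by
    field_simp
    ring
  rw [e x hx, e y hy]
  refine one_add_rpow_le_one_add_rpow hx hxy (by positivity) (by positivity) ?_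
  rw [mul_one_div, mul_one_div, div_le_div_iff₀ (by linarith) (by linarith)]
  nlinarith

lemma add_two_div_self_rpow_half_mono {x y : ℝ} (hx : 0 < x) (hxy : x ≤ y) :
    ((x + 2) / x) ^ (x / 2) ≤ ((y + 2) / y) ^ (y / 2) := by
  have hy : 0 < y := hx.trans_le hxy
  have e (z : ℝ) (hz : 0 < z) : (z + 2) / z = 1 + 2 / z := by
    field_simp
  rw [e x hx, e y hy]
  refine one_add_rpow_le_one_add_rpow (by linarith) (by linarith) (by positivity)
    (by positivity) (le_of_eq ?_)
  field_simp

/-- To bound a real power with rational exponent, compare natural powers. -/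
lemma rpow_le_of_pow_le_pow {b p a : ℝ} {m n : ℕ} (hb : 0 ≤ b) (ha : 0 ≤ a) (hn : n ≠ 0)
    (hp : p * n = m) (h : b ^ m ≤ a ^ n) : b ^ p ≤ a := by
  refine le_of_pow_le_pow_left₀ hn ha ?_
  rwa [← Real.rpow_natCast (b ^ p), ← Real.rpow_mul hb, hp, Real.rpow_natCast]

lemma le_rpow_of_pow_le_pow {b p a : ℝ} {m n : ℕ} (hb : 0 ≤ b) (hn : n ≠ 0)
    (hp : p * n = m) (h : a ^ n ≤ b ^ m) : a ≤ b ^ p := by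
  refine le_of_pow_le_pow_left₀ hn (by positivity) ?_
  rwa [← Real.rpow_natCast (b ^ p), ← Real.rpow_mul hb, hp, Real.rpow_natCast]

lemma add_two_div_add_one_rpow_mul_sub_one_lt {k : ℝ} (hk0 : 0 < k) (hk4 : k ≤ 4) :
    ((k + 2) / (k + 1)) ^ k * (((k + 2) / (k + 1)) ^ k - 1) < ((k + 2) / k) ^ (k / 2) := by
  have hA1 : 1 ≤ ((k + 2) / (k + 1)) ^ k :=
    Real.one_le_rpow (by rw [one_le_div (by linarith)]; linarith) hk0.le
  have hB1 : 1 ≤ ((k + 2) / k) ^ (k / 2) :=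
    Real.one_le_rpow (by rw [one_le_div hk0]; linarith) (by linarith)
  have upper {c : ℝ} (hc : k ≤ c) := add_two_div_add_one_rpow_mono hk0 hc
  have lower {c : ℝ} (hc0 : 0 < c) (hc : c ≤ k) := add_two_div_self_rpow_half_mono hc0 hc
  have of_bounds {a b : ℝ} (ha : ((k + 2) / (k + 1)) ^ k ≤ a)
      (hb : b ≤ ((k + 2) / k) ^ (k / 2)) (hab : a * (a - 1) < b) :
      ((k + 2) / (k + 1)) ^ k * (((k + 2) / (k + 1)) ^ k - 1) < ((k + 2) / k) ^ (k / 2) := by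
    nlinarith
  rcases le_total k 1 with h1 | h1
  · refine of_bounds (a := 3 / 2) (b := 1) ((upper h1).trans ?_) hB1 (by norm_num)
    exact rpow_le_of_pow_le_pow (m := 1) (n := 1) (by norm_num) (by norm_num) (by norm_num)
      (by norm_num) (by norm_num)
  rcases le_total k 2 with h2 | h2
  · refine of_bounds (a := 16 / 9) (b := 17 / 10) ((upper h2).trans ?_)
      (le_trans ?_ (lower one_pos h1)) (by norm_num)
    · exact rpow_le_of_pow_le_pow (m := 2) (n := 1) (by norm_num) (by norm_num) (by norm_num)
        (by norm_num) (by norm_num)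
    · exact le_rpow_of_pow_le_pow (m := 1) (n := 2) (by norm_num) (by norm_num) (by norm_num)
        (by norm_num)
  rcases le_total k 3 with h3 | h3
  · refine of_bounds (a := 125 / 64) (b := 2) ((upper h3).trans ?_)
      (le_trans ?_ (lower two_pos h2)) (by norm_num)
    · exact rpow_le_of_pow_le_pow (m := 3) (n := 1) (by norm_num) (by norm_num) (by norm_num)
        (by norm_num) (by norm_num)
    · exact le_rpow_of_pow_le_pow (m := 1) (n := 1) (by norm_num) (by norm_num) (by norm_num)
        (by norm_num)
  rcases le_total k (15 / 4) with h4 | h4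
  · refine of_bounds (a := 2.048) (b := 2.15) ((upper h4).trans ?_)
      (le_trans ?_ (lower three_pos h3)) (by norm_num)
    · exact rpow_le_of_pow_le_pow (m := 15) (n := 4) (by norm_num) (by norm_num) (by norm_num)
        (by norm_num) (by norm_num)
    · exact le_rpow_of_pow_le_pow (m := 3) (n := 2) (by norm_num) (by norm_num) (by norm_num)
        (by norm_num)
  · refine of_bounds (a := 1296 / 625) (b := 2.228) ((upper hk4).trans ?_)
      (le_trans ?_ (lower (by norm_num) h4)) (by norm_num)
    · exact rpow_le_of_pow_le_pow (m := 4) (n := 1) (by norm_num) (by norm_num) (by norm_num)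
        (by norm_num) (by norm_num)
    · exact le_rpow_of_pow_le_pow (m := 15) (n := 8) (by norm_num) (by norm_num) (by norm_num)
        (by norm_num)

/-- For `0 < k ≤ 4` and `λ ≥ (k+2)^{(k+2)/2}/k^{k/2}`, with `μ = λ/(k+2)` and
`M(ν) = (λ/(λ-ν))^k` the exponential moment of the Gamma distribution, the
hypotheses of the main decay theorem hold: `μ > 1`, `M(2μ) ≤ μ²` and
`M(μ)(M(μ)-1) < μ`. -/
theorem stmt_13 (k l : ℝ) (hk0 : 0 < k) (hk4 : k ≤ 4)
    (hl : (k + 2) ^ ((k + 2) / 2) / k ^ (k / 2) ≤ l)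
    (μ : ℝ) (hμ : μ = l / (k + 2))
    (M : ℝ → ℝ) (hM : ∀ ν, 0 ≤ ν → ν < l → M ν = (l / (l - ν)) ^ k) :
    1 < μ ∧ M (2 * μ) ≤ μ ^ 2 ∧ M μ * (M μ - 1) < μ := by
  have hk2 : 0 < k + 2 := by linarith
  have hle : ((k + 2) / k) ^ (k / 2) ≤ μ := by
    rw [hμ, le_div_iff₀ hk2]
    refine le_of_eq_of_le ?_ hl
    rw [Real.div_rpow hk2.le hk0.le, show (k + 2) / 2 = k / 2 + 1 by ring,
      Real.rpow_add_one hk2.ne', div_mul_eq_mul_div]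
  have h1 : 1 < ((k + 2) / k) ^ (k / 2) :=
    Real.one_lt_rpow (by rw [one_lt_div hk0]; linarith) (by linarith)
  have hμ0 : 0 < μ := by linarith
  obtain rfl : l = μ * (k + 2) := by rw [hμ, div_mul_cancel₀ _ hk2.ne']
  have hM2 : M (2 * μ) = ((k + 2) / k) ^ k := by
    rw [hM _ (by linarith) (by nlinarith), show μ * (k + 2) - 2 * μ = μ * k by ring,
      mul_div_mul_left _ _ hμ0.ne']
  have hM1 : M μ = ((k + 2) / (k + 1)) ^ k := by
    rw [hM _ hμ0.le (by nlinarith), show μ * (k + 2) - μ = μ * (k + 1) by ring,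
      mul_div_mul_left _ _ hμ0.ne']
  refine ⟨h1.trans_le hle, ?_, ?_⟩
  · calc M (2 * μ) = (((k + 2) / k) ^ (k / 2)) ^ 2 := by
          rw [hM2, ← Real.rpow_mul_natCast (by positivity)]
          norm_num
      _ ≤ μ ^ 2 := by gcongr
  · rw [hM1]
    exact (add_two_div_add_one_rpow_mul_sub_one_lt hk0 hk4).trans_le hle
end

section
/- Let λ ≥ 3^{3/2}, let P be the exponential distribution with density s ↦ λ e^{−λ s} on (0,∞), and let u : ℝ → ℝ be continuous with u(t) = 1 for t ≤ 0, differentiable at every t > 0, with s ↦ u(t−s) P-integrable and u'(t) = −∫_0^∞ u(t−s) λ e^{−λ s} ds for all t > 0. Then 9/(4λ) − 1 < 0 and u(t)² ≤ exp( 2·(9/(4λ) − 1)·t ) for all t ≥ 0; in particular u decays exponentially to 0. -/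
open MeasureTheory Filter

/-- Convolution of a history that is constant equal to `1` on the negative half-line with an
exponential density, written as an integral over a compact interval. -/
lemma integral_expDelay_eq {l : ℝ} (hl : 0 < l) {u : ℝ → ℝ} (hu_init : ∀ t ≤ (0 : ℝ), u t = 1)
    {t : ℝ} (ht : 0 < t)
    (hint : IntegrableOn (fun s => u (t - s) * (l * Real.exp (-l * s))) (Set.Ioi 0)) :
    ∫ s in Set.Ioi (0 : ℝ), u (t - s) * (l * Real.exp (-l * s)) =
      Real.exp (-l * t) * (1 + ∫ r in (0 : ℝ)..t, l * Real.exp (l * r) * u r) := by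
  rw [← intervalIntegral.integral_interval_add_Ioi hint
    (hint.mono_set (Set.Ioi_subset_Ioi ht.le))]
  have htail : ∫ s in Set.Ioi t, u (t - s) * (l * Real.exp (-l * s)) = Real.exp (-l * t) := by
    rw [setIntegral_congr_fun (g := fun s => l * Real.exp (-l * s)) measurableSet_Ioi
      fun s (hs : t < s) => by simp [hu_init (t - s) (by linarith)],
      integral_const_mul, integral_exp_mul_Ioi (by linarith)]
    field_simp
  have hhead : ∫ s in (0 : ℝ)..t, u (t - s) * (l * Real.exp (-l * s)) =
      Real.exp (-l * t) * ∫ r in (0 : ℝ)..t, l * Real.exp (l * r) * u r := by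
    have hsub := intervalIntegral.integral_comp_sub_left (a := 0) (b := t)
      (fun r => l * Real.exp (l * r) * u r) t
    rw [sub_self, sub_zero] at hsub
    rw [← hsub, ← intervalIntegral.integral_const_mul]
    refine intervalIntegral.integral_congr fun s _ => ?_
    have hexp : Real.exp (-l * s) = Real.exp (-l * t) * Real.exp (l * (t - s)) := by
      rw [← Real.exp_add]
      ring_nf
    simp only [hexp]
    ring
  rw [htail, hhead]
  ring

/-- A function that satisfies `f' = -k f` on the positive half-line and is continuous up to `0` is
an exponential. -/
lemma eq_mul_exp_of_hasDerivAt {f : ℝ → ℝ} {k : ℝ} (hf : Continuous f)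
    (hf' : ∀ t > 0, HasDerivAt f (-k * f t) t) {t : ℝ} (ht : 0 ≤ t) :
    f t = f 0 * Real.exp (-k * t) := by
  rcases ht.eq_or_lt with rfl | ht
  · simp
  have hder : ∀ s ∈ Set.Ioo 0 t, HasDerivAt (fun s => f s * Real.exp (k * s)) 0 s := by
    intro s hs
    have hexp : HasDerivAt (fun s => Real.exp (k * s)) (Real.exp (k * s) * k) s := by
      simpa using ((hasDerivAt_id s).const_mul k).exp
    exact ((hf' s hs.1).mul hexp).congr_deriv (by ring)
  obtain ⟨s, -, hs⟩ := exists_hasDerivAt_eq_slope _ (fun _ => 0) ht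
    (by fun_prop : Continuous fun s => f s * Real.exp (k * s)).continuousOn hder
  have hconst : f t * Real.exp (k * t) = f 0 := by
    rw [eq_comm, div_eq_zero_iff] at hs
    rcases hs with hs | hs
    · simpa [sub_eq_zero] using hs
    · linarith
  rw [← hconst, mul_assoc, ← Real.exp_add]
  simp

/-- In the overdamped case, with `a < b` the decay rates of the feedback loop, the explicit
solution is nonnegative and decays at least as fast as `exp (-t)`. -/
lemma expDelay_solution_bounds {a b t x : ℝ} (ha : 1 < a) (hab : a < b) (ht : 0 ≤ t)
    (hx : (b - a) * x = (b - 1) * Real.exp (-a * t) - (a - 1) * Real.exp (-b * t)) :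
    0 ≤ x ∧ x ≤ Real.exp (-t) := by
  have hba : 0 < b - a := sub_pos.2 hab
  have hb1 : 0 < b - 1 := by linarith
  constructor
  · refine nonneg_of_mul_nonneg_right (a := b - a) ?_ hba
    have hexp : Real.exp (-b * t) ≤ Real.exp (-a * t) := Real.exp_le_exp.2 (by nlinarith)
    have := Real.exp_pos (-b * t)
    rw [hx]
    nlinarith
  · refine le_of_mul_le_mul_left (a := b - a) ?_ hba
    have hweight : 0 ≤ (b - a) / (b - 1) := by positivity
    have hweight' : 0 ≤ (a - 1) / (b - 1) := div_nonneg (by linarith) hb1.le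
    have hconv := convexOn_exp.2 (Set.mem_univ (-t)) (Set.mem_univ (-b * t)) hweight hweight'
      (by field_simp; ring)
    have hpt : (b - a) / (b - 1) * -t + (a - 1) / (b - 1) * (-b * t) = -a * t := by
      field_simp
      ring
    simp only [smul_eq_mul, hpt] at hconv
    have hmul := mul_le_mul_of_nonneg_left hconv hb1.le
    have hrhs : (b - 1) * ((b - a) / (b - 1) * Real.exp (-t) +
        (a - 1) / (b - 1) * Real.exp (-b * t)) =
        (b - a) * Real.exp (-t) + (a - 1) * Real.exp (-b * t) := by
      field_simp
    linarith

/-- The solution of the feedback loop with exponentially distributed delay of rate `l > 4` is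
nonnegative and bounded by `exp (-t)`. -/
lemma expDelay_bounds {l : ℝ} (hl : 4 < l) {u : ℝ → ℝ} (hu_cont : Continuous u)
    (hu_init : ∀ t ≤ (0 : ℝ), u t = 1)
    (hu_int : ∀ t > (0 : ℝ),
      IntegrableOn (fun s => u (t - s) * (l * Real.exp (-l * s))) (Set.Ioi 0))
    (hu_ode : ∀ t > (0 : ℝ),
      HasDerivAt u (-∫ s in Set.Ioi (0 : ℝ), u (t - s) * (l * Real.exp (-l * s))) t)
    {t : ℝ} (ht : 0 ≤ t) : 0 ≤ u t ∧ u t ≤ Real.exp (-t) := by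
  set v : ℝ → ℝ := fun t =>
    Real.exp (-l * t) * (1 + ∫ r in (0 : ℝ)..t, l * Real.exp (l * r) * u r) with hv
  have hv' : ∀ t, HasDerivAt v (l * (u t - v t)) t := by
    intro t
    have hcont : Continuous fun r => l * Real.exp (l * r) * u r := by fun_prop
    have hprim := (hcont.integral_hasStrictDerivAt 0 t).hasDerivAt.const_add 1
    have hexp : HasDerivAt (fun t => Real.exp (-l * t)) (Real.exp (-l * t) * -l) t := by
      simpa using ((hasDerivAt_id t).const_mul (-l)).exp
    refine (hexp.mul hprim).congr_deriv ?_
    have hinv : Real.exp (-l * t) * Real.exp (l * t) = 1 := by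
      simp [← Real.exp_add]
    simp only [hv]
    linear_combination l * u t * hinv
  have hv_cont : Continuous v := continuous_iff_continuousAt.2 fun t => (hv' t).continuousAt
  have hu' : ∀ t > 0, HasDerivAt u (-v t) t := fun t ht => by
    have := hu_ode t ht
    rwa [integral_expDelay_eq (by linarith) hu_init ht (hu_int t ht)] at this
  have hmode : ∀ a b : ℝ, a + b = l → a * b = l → v t - a * u t = (1 - a) * Real.exp (-b * t) := by
    intro a b hsum hprod
    have h := eq_mul_exp_of_hasDerivAt (f := fun t => v t - a * u t) (k := b) (by fun_prop)
      (fun s hs => by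
        refine ((hv' s).sub ((hu' s hs).const_mul a)).congr_deriv ?_
        linear_combination v s * hsum - u s * hprod) ht
    simpa [hv, hu_init 0 le_rfl] using h
  set q := Real.sqrt (l ^ 2 - 4 * l)
  have hq_sq : q ^ 2 = l ^ 2 - 4 * l := Real.sq_sqrt (by nlinarith)
  have hq_pos : 0 < q := Real.sqrt_pos.2 (by nlinarith)
  have hq_lt : q < l - 2 := by nlinarith
  have hslow := hmode ((l - q) / 2) ((l + q) / 2) (by ring) (by linear_combination -hq_sq / 4)
  have hfast := hmode ((l + q) / 2) ((l - q) / 2) (by ring) (by linear_combination -hq_sq / 4)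
  exact expDelay_solution_bounds (a := (l - q) / 2) (b := (l + q) / 2) (by linarith) (by linarith)
    ht (by linear_combination hslow - hfast)

/-- Exponential decay for the negative feedback loop with exponentially
distributed delay of rate `λ ≥ 3^{3/2}`: the decay coefficient `9/(4λ) - 1` is
negative and `u(t)² ≤ exp(2(9/(4λ)-1)t)` for `t ≥ 0`; in particular `u → 0`. -/
theorem stmt_14 (l : ℝ) (hl : (3 : ℝ) ^ ((3 : ℝ) / 2) ≤ l)
    (u : ℝ → ℝ) (hu_cont : Continuous u)
    (hu_init : ∀ t ≤ (0 : ℝ), u t = 1)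
    (hu_int : ∀ t > (0 : ℝ),
      IntegrableOn (fun s => u (t - s) * (l * Real.exp (-l * s))) (Set.Ioi 0))
    (hu_ode : ∀ t > (0 : ℝ),
      HasDerivAt u (-∫ s in Set.Ioi (0 : ℝ), u (t - s) * (l * Real.exp (-l * s))) t) :
    9 / (4 * l) - 1 < 0 ∧
    (∀ t ≥ (0 : ℝ), u t ^ 2 ≤ Real.exp (2 * (9 / (4 * l) - 1) * t)) ∧
    Tendsto u atTop (nhds 0) := by
  have hl5 : 5 < l := by
    refine lt_of_lt_of_le ?_ hl
    have hsq : ((3 : ℝ) ^ ((3 : ℝ) / 2)) ^ 2 = 27 := by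
      rw [← Real.rpow_natCast, ← Real.rpow_mul (by norm_num)]
      norm_num
    have : (0 : ℝ) < 3 ^ ((3 : ℝ) / 2) := by positivity
    nlinarith
  have hbounds := fun t (ht : 0 ≤ t) =>
    expDelay_bounds (by linarith) hu_cont hu_init hu_int hu_ode ht
  have hrate : 0 < 9 / (4 * l) := by positivity
  refine ⟨?_, fun t ht => ?_, ?_⟩
  · rw [sub_neg, div_lt_one (by linarith)]
    linarith
  · obtain ⟨hnonneg, hle⟩ := hbounds t ht
    calc u t ^ 2 ≤ Real.exp (-t) ^ 2 := by gcongr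
      _ = Real.exp (2 * -t) := by
        rw [← Real.exp_nat_mul]
        norm_num
      _ ≤ Real.exp (2 * (9 / (4 * l) - 1) * t) := Real.exp_le_exp.2 (by nlinarith)
  · refine tendsto_of_tendsto_of_tendsto_of_le_of_le' tendsto_const_nhds
      (Real.tendsto_exp_neg_atTop_nhds_zero) ?_ ?_
    · filter_upwards [eventually_ge_atTop 0] with t ht using (hbounds t ht).1
    · filter_upwards [eventually_ge_atTop 0] with t ht using (hbounds t ht).2
end

section
/- Let 0 ≤ a < b < (ln 2)/2 and let M(ν) := ( e^{ν b} − e^{ν a} ) / ( (b−a)·ν ) for ν > 0 (the exponential moment of the uniform distribution on [a,b]). Then μ = 2 satisfies M(4) ≤ 4 and M(2)·(M(2) − 1) < 2; i.e., the hypotheses of the main decay theorem hold for the uniform distribution on [a,b]. -/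
/-- The average of `exp` over `[ν * a, ν * b]` is at most its value at the right endpoint. -/
lemma exp_sub_exp_div_le {a b ν : ℝ} (hab : a < b) (hν : 0 < ν) :
    (Real.exp (ν * b) - Real.exp (ν * a)) / ((b - a) * ν) ≤ Real.exp (ν * b) := by
  rw [div_le_iff₀ (mul_pos (sub_pos.2 hab) hν)]
  have h : Real.exp (ν * a) = Real.exp (ν * b) * Real.exp (ν * a - ν * b) := by
    rw [← Real.exp_add]
    ring_nf
  have h' := mul_le_mul_of_nonneg_left (Real.add_one_le_exp (ν * a - ν * b))
    (Real.exp_pos (ν * b)).le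
  rw [← h] at h'
  linarith

/-- For the uniform distribution on `[a,b]` with `0 ≤ a < b < (ln 2)/2`, the
choice `μ = 2` verifies the hypotheses of the main decay theorem:
`M(4) ≤ 4 = μ²` and `M(2)(M(2)-1) < 2 = μ`, where
`M(ν) = (e^{νb} - e^{νa})/((b-a)ν)`. -/
theorem stmt_15 (a b : ℝ) (ha : 0 ≤ a) (hab : a < b) (hb : b < Real.log 2 / 2)
    (M : ℝ → ℝ)
    (hM : ∀ ν : ℝ, 0 < ν → M ν = (Real.exp (ν * b) - Real.exp (ν * a)) / ((b - a) * ν)) :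
    M 4 ≤ 4 ∧ M 2 * (M 2 - 1) < 2 := by
  have hlog : Real.exp (Real.log 2) = 2 := Real.exp_log two_pos
  have h4 : Real.exp (4 * b) < 4 := by
    calc Real.exp (4 * b) < Real.exp (Real.log 2 + Real.log 2) :=
          Real.exp_lt_exp.2 (by linarith)
      _ = 4 := by rw [Real.exp_add, hlog]; norm_num
  have h2 : Real.exp (2 * b) < 2 := by
    calc Real.exp (2 * b) < Real.exp (Real.log 2) := Real.exp_lt_exp.2 (by linarith)
      _ = 2 := hlog
  have hM4 : M 4 ≤ Real.exp (4 * b) := by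
    rw [hM 4 (by norm_num)]
    exact exp_sub_exp_div_le hab (by norm_num)
  have hM2 : M 2 ≤ Real.exp (2 * b) := by
    rw [hM 2 two_pos]
    exact exp_sub_exp_div_le hab two_pos
  have hM2_pos : 0 < M 2 := by
    rw [hM 2 two_pos]
    exact div_pos (sub_pos.2 (Real.exp_lt_exp.2 (by linarith)))
      (mul_pos (sub_pos.2 hab) two_pos)
  exact ⟨by linarith, by nlinarith⟩
end

section
/- Let m ∈ ℝ, σ > 0 and μ ≥ 0. Then the exponential moment of the truncated normal distribution satisfies ( ∫_0^∞ e^{μ s} e^{−(s−m)²/(2σ²)} ds ) / ( ∫_0^∞ e^{−(s−m)²/(2σ²)} ds ) ≥ e^{mμ}. -/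
open MeasureTheory Filter Topology

/-- The first moment of a Gaussian weight about its centre `m`, over the half-line `(0,∞)`. -/
theorem integral_Ioi_sub_mul_exp_neg_sq_div (m : ℝ) {σ : ℝ} (hσ : 0 < σ) :
    ∫ s in Set.Ioi (0 : ℝ), (s - m) * Real.exp (-(s - m) ^ 2 / (2 * σ ^ 2)) =
      σ ^ 2 * Real.exp (-m ^ 2 / (2 * σ ^ 2)) := by
  have hb : 0 < 1 / (2 * σ ^ 2) := by positivity
  have hint : Integrable fun s : ℝ => (s - m) * Real.exp (-(s - m) ^ 2 / (2 * σ ^ 2)) := by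
    convert (integrable_mul_exp_neg_mul_sq hb).comp_sub_right m using 4
    ring
  have hderiv (s : ℝ) : HasDerivAt (fun s => -σ ^ 2 * Real.exp (-(s - m) ^ 2 / (2 * σ ^ 2)))
      ((s - m) * Real.exp (-(s - m) ^ 2 / (2 * σ ^ 2))) s := by
    have h := (((((hasDerivAt_id s).sub_const m).pow 2).neg.div_const (2 * σ ^ 2)).exp).const_mul
      (-σ ^ 2)
    refine h.congr_deriv ?_
    simp
    field_simp
  have hlim : Tendsto (fun s => -σ ^ 2 * Real.exp (-(s - m) ^ 2 / (2 * σ ^ 2))) atTop (𝓝 0) := by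
    rw [← mul_zero (-σ ^ 2)]
    refine (Real.tendsto_exp_atBot.comp ?_).const_mul _
    refine Tendsto.atBot_div_const (by positivity) (tendsto_neg_atTop_atBot.comp ?_)
    exact (tendsto_pow_atTop two_ne_zero).comp (tendsto_atTop_add_const_right _ (-m) tendsto_id)
  rw [integral_Ioi_of_hasDerivAt_of_tendsto' (fun s _ => hderiv s) hint.integrableOn hlim]
  simp

/-- A Gaussian weight is integrable. -/
theorem integrable_exp_neg_sub_sq_div (m : ℝ) {σ : ℝ} (hσ : 0 < σ) :
    Integrable fun s : ℝ => Real.exp (-(s - m) ^ 2 / (2 * σ ^ 2)) := by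
  have hb : 0 < 1 / (2 * σ ^ 2) := by positivity
  convert (integrable_exp_neg_mul_sq hb).comp_sub_right m using 3
  ring

/-- An exponentially tilted Gaussian weight is integrable. -/
theorem integrable_exp_mul_mul_exp_neg_sub_sq_div (m μ : ℝ) {σ : ℝ} (hσ : 0 < σ) :
    Integrable fun s : ℝ => Real.exp (μ * s) * Real.exp (-(s - m) ^ 2 / (2 * σ ^ 2)) := by
  convert (integrable_exp_neg_sub_sq_div (m + μ * σ ^ 2) hσ).const_mul
    (Real.exp (μ * m + μ ^ 2 * σ ^ 2 / 2)) using 2 with s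
  rw [← Real.exp_add, ← Real.exp_add]
  congr 1
  field_simp
  ring

/-- Lower bound `e^{mμ}` for the exponential moment (at `μ ≥ 0`) of the normal
distribution with parameters `m, σ` truncated to `(0,∞)`. -/
theorem stmt_17 (m σ μ : ℝ) (hσ : 0 < σ) (hμ : 0 ≤ μ) :
    Real.exp (m * μ) ≤
      (∫ s in Set.Ioi (0 : ℝ), Real.exp (μ * s) * Real.exp (-(s - m) ^ 2 / (2 * σ ^ 2))) /
        (∫ s in Set.Ioi (0 : ℝ), Real.exp (-(s - m) ^ 2 / (2 * σ ^ 2))) := by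
  have hg := (integrable_exp_neg_sub_sq_div m hσ).integrableOn (s := Set.Ioi 0)
  have hpos : 0 < ∫ s in Set.Ioi (0 : ℝ), Real.exp (-(s - m) ^ 2 / (2 * σ ^ 2)) := by
    have : NeZero (volume.restrict (Set.Ioi (0 : ℝ))) := ⟨by simp⟩
    exact integral_exp_pos hg
  have hfirst := integral_Ioi_sub_mul_exp_neg_sq_div m hσ
  have hfirst_pos : 0 < σ ^ 2 * Real.exp (-m ^ 2 / (2 * σ ^ 2)) := by positivity
  have hfirst_int : IntegrableOn
      (fun s : ℝ => (s - m) * Real.exp (-(s - m) ^ 2 / (2 * σ ^ 2))) (Set.Ioi 0) :=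
    Integrable.of_integral_ne_zero (by rw [hfirst]; exact hfirst_pos.ne')
  rw [le_div_iff₀ hpos]
  calc
    _ ≤ Real.exp (m * μ) * (∫ s in Set.Ioi (0 : ℝ), Real.exp (-(s - m) ^ 2 / (2 * σ ^ 2))) +
        Real.exp (m * μ) * μ *
          ∫ s in Set.Ioi (0 : ℝ), (s - m) * Real.exp (-(s - m) ^ 2 / (2 * σ ^ 2)) := by
      rw [hfirst]
      exact le_add_of_nonneg_right (by positivity)
    _ = ∫ s in Set.Ioi (0 : ℝ), (Real.exp (m * μ) * Real.exp (-(s - m) ^ 2 / (2 * σ ^ 2)) +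
        Real.exp (m * μ) * μ * ((s - m) * Real.exp (-(s - m) ^ 2 / (2 * σ ^ 2)))) := by
      rw [integral_add (hg.const_mul _) (hfirst_int.const_mul _), integral_const_mul,
        integral_const_mul]
    _ ≤ _ := by
      refine integral_mono ((hg.const_mul _).add (hfirst_int.const_mul _))
        (integrable_exp_mul_mul_exp_neg_sub_sq_div m μ hσ).integrableOn fun s => ?_
      have htangent : Real.exp (m * μ) * (μ * (s - m) + 1) ≤ Real.exp (μ * s) := by
        rw [show μ * s = m * μ + μ * (s - m) by ring, Real.exp_add]
        gcongr
        exact Real.add_one_le_exp _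
      calc
        _ = Real.exp (m * μ) * (μ * (s - m) + 1) * Real.exp (-(s - m) ^ 2 / (2 * σ ^ 2)) := by ring
        _ ≤ _ := by gcongr
end
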